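/- arXiv:2107.11841 — 2 statements merged into one kernel-verified Lean document; each statement's English description precedes it below -/
import Mathlib

section
/- The HyperCTL* model checking problem is decidable: there is an algorithm that, given a finite Kripke structure K and a HyperCTL* sentence φ, decides whether K ⊨ φ. -/
/-!
STATEMENT 2: The HyperCTL* model checking problem is decidable: there is an
algorithm that, given a finite Kripke structure K and a HyperCTL* sentence φ,
decides whether K ⊨ φ.
-/

/-- A finite Kripke structure: finitely many states `Fin n`, an initial state,
a transition function with nonempty successor sets, and a state labeling. -/
structure FinKripke where
  n : ℕ
  init : Fin n
  trans : Fin n → Finset (Fin n)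
  trans_nonempty : ∀ s, (trans s).Nonempty
  label : Fin n → Finset ℕ

/-- Paths of `K` starting in state `s`. -/
def FinKripke.PathFrom (K : FinKripke) (s : Fin K.n) (p : ℕ → Fin K.n) : Prop :=
  p 0 = s ∧ ∀ i, p (i + 1) ∈ K.trans (p i)

/-- HyperCTL* formulas: `a_π | ¬φ | φ ∨ φ | X φ | φ U φ | ∃π.φ`. -/
inductive HCTL : Type
  | atom : ℕ → ℕ → HCTL          -- `a_π` (proposition, path variable)
  | not : HCTL → HCTL
  | or : HCTL → HCTL → HCTL
  | next : HCTL → HCTL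
  | xuntil : HCTL → HCTL → HCTL
  | ex : ℕ → HCTL → HCTL         -- `∃π.φ`

/-- Satisfaction `K, Π, i ⊨ φ` of a HyperCTL* formula: `Pi` assigns path
variables to paths of `K`, and `cur` is the path assigned to the special
variable `ε` denoting the most recently quantified path (for the empty
assignment, `ε` yields the initial state). -/
def HCTL.Sat (K : FinKripke) :
    (ℕ → (ℕ → Fin K.n)) → (ℕ → Fin K.n) → ℕ → HCTL → Prop
  | Pi, _, i, .atom a π => a ∈ K.label (Pi π i)
  | Pi, cur, i, .not φ => ¬ HCTL.Sat K Pi cur i φ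
  | Pi, cur, i, .or φ₁ φ₂ => HCTL.Sat K Pi cur i φ₁ ∨ HCTL.Sat K Pi cur i φ₂
  | Pi, cur, i, .next φ => HCTL.Sat K Pi cur (i + 1) φ
  | Pi, cur, i, .xuntil φ₁ φ₂ =>
      ∃ k, i ≤ k ∧ HCTL.Sat K Pi cur k φ₂ ∧
        ∀ j, i ≤ j → j < k → HCTL.Sat K Pi cur j φ₁
  | Pi, cur, i, .ex π φ =>
      ∃ p : ℕ → Fin K.n, K.PathFrom (cur i) p ∧
        HCTL.Sat K (Function.update Pi π p) p i φ

/-- Free path variables of a HyperCTL* formula. -/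
def HCTL.free : HCTL → Finset ℕ
  | .atom _ π => {π}
  | .not φ => φ.free
  | .or φ₁ φ₂ => φ₁.free ∪ φ₂.free
  | .next φ => φ.free
  | .xuntil φ₁ φ₂ => φ₁.free ∪ φ₂.free
  | .ex π φ => φ.free \ {π}

/-- `Guarded φ b` holds iff all temporal operators in `φ` occur inside the
scope of a path quantifier (`b` records whether we are already in the scope
of a quantifier). -/
def HCTL.Guarded : HCTL → Bool → Prop
  | .atom _ _, _ => True
  | .not φ, b => HCTL.Guarded φ b
  | .or φ₁ φ₂, b => HCTL.Guarded φ₁ b ∧ HCTL.Guarded φ₂ b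
  | .next φ, b => b = true ∧ HCTL.Guarded φ b
  | .xuntil φ₁ φ₂, b => b = true ∧ HCTL.Guarded φ₁ b ∧ HCTL.Guarded φ₂ b
  | .ex _ φ, _ => HCTL.Guarded φ true

/-- A HyperCTL* sentence: closed, with temporal operators only inside the
scope of path quantifiers. -/
def HCTL.Sentence (φ : HCTL) : Prop := φ.free = ∅ ∧ φ.Guarded false

/-- `K ⊨ φ` iff `K, ∅, 0 ⊨ φ` (the empty assignment maps `ε` to the initial
state). -/
def FinKripke.Models (K : FinKripke) (φ : HCTL) : Prop :=
  HCTL.Sat K (fun _ _ => K.init) (fun _ => K.init) 0 φ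

/-- An explicit (injective) numerical encoding of HyperCTL* formulas. -/
def HCTL.enc : HCTL → ℕ
  | .atom a π => Nat.pair 0 (Nat.pair a π)
  | .not φ => Nat.pair 1 φ.enc
  | .or φ₁ φ₂ => Nat.pair 2 (Nat.pair φ₁.enc φ₂.enc)
  | .next φ => Nat.pair 3 φ.enc
  | .xuntil φ₁ φ₂ => Nat.pair 4 (Nat.pair φ₁.enc φ₂.enc)
  | .ex π φ => Nat.pair 5 (Nat.pair π φ.enc)

/-- An explicit (injective) numerical encoding of finite Kripke structures. -/
def FinKripke.enc (K : FinKripke) : ℕ :=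
  Nat.pair K.n (Nat.pair K.init.val (Nat.pair
    (Encodable.encode
      ((List.finRange K.n).map fun s => ((K.trans s).sort (· ≤ ·)).map Fin.val))
    (Encodable.encode
      ((List.finRange K.n).map fun s => (K.label s).sort (· ≤ ·)))))

namespace HC

/-- Shift of an infinite word. -/
def sh {A : Type} (n : ℕ) (u : ℕ → A) : ℕ → A := fun k => u (n + k)

/-- An omega-language `P` is recognised by a finite colouring with at most `c` colours. -/
def Rec {A : Type} (P : (ℕ → A) → Prop) (c : ℕ) : Prop :=
  ∃ (Q : Type) (_ : Finite Q) (h : ℕ → (ℕ → A) → Q), Nat.card Q ≤ c ∧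
    (∀ l u v, (∀ k < l, u k = v k) → h l u = h l v) ∧
    (∀ l u l' u' m m', h l u = h l' u' → h m (sh l u) = h m' (sh l' u') →
      h (l + m) u = h (l' + m') u') ∧
    (∀ u u' (f f' : ℕ → ℕ), StrictMono f → f 0 = 0 → StrictMono f' → f' 0 = 0 →
      (∀ i, h (f (i + 1) - f i) (sh (f i) u) = h (f' (i + 1) - f' i) (sh (f' i) u')) →
      P u → P u')

theorem Rec.mono {A : Type} {P : (ℕ → A) → Prop} {c d : ℕ} (h : Rec P c) (hcd : c ≤ d) :
    Rec P d := by
  obtain ⟨Q, hQ, h, hc, h1⟩ := h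
  exact ⟨Q, hQ, h, hc.trans hcd, h1⟩

theorem Rec.not {A : Type} {P : (ℕ → A) → Prop} {c : ℕ} (h : Rec P c) :
    Rec (fun u => ¬ P u) c := by
  obtain ⟨Q, hQ, h, hc, h1, h2, h3⟩ := h
  exact ⟨Q, hQ, h, hc, h1, h2, fun u u' f f' hf hf0 hf' hf0' he hu hu' =>
    hu (h3 u' u f' f hf' hf0' hf hf0 (fun i => (he i).symm) hu')⟩

theorem Rec.and {A : Type} {P P' : (ℕ → A) → Prop} {c c' : ℕ} (h : Rec P c) (h' : Rec P' c') :
    Rec (fun u => P u ∧ P' u) (c * c') := by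
  obtain ⟨Q, hQ, h, hc, h1, h2, h3⟩ := h
  obtain ⟨Q', hQ', h', hc', h1', h2', h3'⟩ := h'
  refine ⟨Q × Q', inferInstance, fun l u => (h l u, h' l u), ?_, ?_, ?_, ?_⟩
  · rw [Nat.card_prod]; exact Nat.mul_le_mul hc hc'
  · intro l u v huv
    exact Prod.ext (h1 l u v huv) (h1' l u v huv)
  · intro l u l' u' m m' e1 e2
    simp only [Prod.mk.injEq] at e1 e2 ⊢
    exact ⟨h2 _ _ _ _ _ _ e1.1 e2.1, h2' _ _ _ _ _ _ e1.2 e2.2⟩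
  · intro u u' f f' hf hf0 hf' hf0' he hu
    simp only [Prod.mk.injEq] at he
    exact ⟨h3 u u' f f' hf hf0 hf' hf0' (fun i => (he i).1) hu.1,
      h3' u u' f f' hf hf0 hf' hf0' (fun i => (he i).2) hu.2⟩

theorem Rec.congr {A : Type} {P P' : (ℕ → A) → Prop} {c : ℕ} (h : Rec P c)
    (hP : ∀ u, P u ↔ P' u) : Rec P' c := by
  have : P = P' := funext fun u => propext (hP u)
  rwa [← this]

theorem Rec.or {A : Type} {P P' : (ℕ → A) → Prop} {c c' : ℕ} (h : Rec P c) (h' : Rec P' c') :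
    Rec (fun u => P u ∨ P' u) (c * c') :=
  (h.not.and h'.not).not.congr (fun u => by tauto)

theorem Rec.map {A B : Type} {P : (ℕ → B) → Prop} {c : ℕ} (g : A → B) (h : Rec P c) :
    Rec (fun u : ℕ → A => P (fun k => g (u k))) c := by
  obtain ⟨Q, hQ, h, hc, h1, h2, h3⟩ := h
  refine ⟨Q, hQ, fun l u => h l (fun k => g (u k)), hc, ?_, ?_, ?_⟩
  · intro l u v huv
    exact h1 _ _ _ (fun k hk => by rw [huv k hk])
  · intro l u l' u' m m' e1 e2
    exact h2 _ _ _ _ _ _ e1 e2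
  · intro u u' f f' hf hf0 hf' hf0' he hu
    exact h3 (fun k => g (u k)) (fun k => g (u' k)) f f' hf hf0 hf' hf0' he hu

theorem idx_eq {f : ℕ → ℕ} (hf : StrictMono f) {i k : ℕ} (h1 : f i ≤ k) (h2 : k < f (i + 1)) :
    Nat.findGreatest (fun i => f i ≤ k) k = i := by
  rw [Nat.findGreatest_eq_iff]
  refine ⟨(hf.id_le i).trans h1, fun _ => h1, fun n hn _ h => ?_⟩
  have := hf.monotone (show i + 1 ≤ n from hn)
  omega

theorem idx_ex {f : ℕ → ℕ} (hf : StrictMono f) (h0 : f 0 = 0) (k : ℕ) :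
    ∃ i, f i ≤ k ∧ k < f (i + 1) := by
  refine ⟨Nat.findGreatest (fun i => f i ≤ k) k, ?_, ?_⟩
  · exact Nat.findGreatest_spec (P := fun i => f i ≤ k) (Nat.zero_le k) (by simp [h0])
  · by_contra hc
    push Not at hc
    have hle : Nat.findGreatest (fun i => f i ≤ k) k + 1 ≤ k := (hf.id_le _).trans hc
    have := Nat.le_findGreatest (P := fun i => f i ≤ k) hle hc
    omega

theorem Rec.proj {A B : Type} {P : (ℕ → A × B) → Prop} {c : ℕ} (h : Rec P c) :
    Rec (fun u : ℕ → A => ∃ v : ℕ → B, P (fun k => (u k, v k))) (2 ^ c) := by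
  obtain ⟨Q, hQ, h, hc, h1, h2, h3⟩ := h
  refine ⟨Set Q, inferInstance,
    fun l u => {q | ∃ v : ℕ → B, h l (fun k => (u k, v k)) = q}, ?_, ?_, ?_, ?_⟩
  · have := Fintype.ofFinite Q
    have e : Nat.card (Set Q) = 2 ^ Nat.card Q := by
      rw [Nat.card_eq_fintype_card, Nat.card_eq_fintype_card, Fintype.card_set]
    rw [e]
    exact Nat.pow_le_pow_right (by norm_num) hc
  · intro l u v huv
    ext q
    have : ∀ w : ℕ → B, h l (fun k => (u k, w k)) = h l (fun k => (v k, w k)) :=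
      fun w => h1 _ _ _ (fun k hk => by rw [huv k hk])
    simp [this]
  · have key : ∀ (l : ℕ) (u : ℕ → A) (l' : ℕ) (u' : ℕ → A) (m m' : ℕ),
        {q | ∃ v : ℕ → B, h l (fun k => (u k, v k)) = q} =
          {q | ∃ v : ℕ → B, h l' (fun k => (u' k, v k)) = q} →
        {q | ∃ v : ℕ → B, h m (fun k => (sh l u k, v k)) = q} =
          {q | ∃ v : ℕ → B, h m' (fun k => (sh l' u' k, v k)) = q} →
        {q | ∃ v : ℕ → B, h (l + m) (fun k => (u k, v k)) = q} ⊆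
          {q | ∃ v : ℕ → B, h (l' + m') (fun k => (u' k, v k)) = q} := by
      rintro l u l' u' m m' e1 e2 q ⟨v, hv⟩
      have a1 : h l (fun k => (u k, v k)) ∈
          {q | ∃ v : ℕ → B, h l' (fun k => (u' k, v k)) = q} := by
        rw [← e1]; exact ⟨v, rfl⟩
      have a2 : h m (fun k => (sh l u k, sh l v k)) ∈
          {q | ∃ v : ℕ → B, h m' (fun k => (sh l' u' k, v k)) = q} := by
        rw [← e2]; exact ⟨sh l v, rfl⟩
      obtain ⟨v1, hv1⟩ := a1
      obtain ⟨v2, hv2⟩ := a2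
      refine ⟨fun k => if k < l' then v1 k else v2 (k - l'), ?_⟩
      rw [← hv]
      apply h2
      · rw [← hv1]
        exact h1 _ _ _ (fun k hk => by simp [hk])
      · refine Eq.trans ?_ hv2
        exact h1 _ _ _ (fun k hk => by simp [sh])
    intro l u l' u' m m' e1 e2
    exact Set.Subset.antisymm (key _ _ _ _ _ _ e1 e2) (key _ _ _ _ _ _ e1.symm e2.symm)
  · rintro u u' f f' hf hf0 hf' hf0' he ⟨v, hv⟩
    have : ∀ i, ∃ w : ℕ → B, h (f' (i + 1) - f' i) (fun k => (sh (f' i) u' k, w k)) =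
        h (f (i + 1) - f i) (fun k => (sh (f i) u k, sh (f i) v k)) := by
      intro i
      have : h (f (i + 1) - f i) (fun k => (sh (f i) u k, sh (f i) v k)) ∈
          {q | ∃ v : ℕ → B, h (f' (i + 1) - f' i) (fun k => (sh (f' i) u' k, v k)) = q} := by
        have e := he i
        simp only at e
        rw [← e]; exact ⟨_, rfl⟩
      exact this
    choose w hw using this
    refine ⟨fun k => w (Nat.findGreatest (fun i => f' i ≤ k) k)
      (k - f' (Nat.findGreatest (fun i => f' i ≤ k) k)), ?_⟩
    refine h3 _ _ f f' hf hf0 hf' hf0' (fun i => ?_) hv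
    refine (hw i).symm.trans ?_
    apply h1
    intro k hk
    have := idx_eq hf' (i := i) (k := f' i + k) (by omega) (by omega)
    simp only [sh]
    rw [this]
    simp

theorem Rec.base {B : Type} [Finite B] (G : B → Set (B × B) → Prop) :
    Rec (fun u : ℕ → B => G (u 0) {x | ∃ k, x = (u k, u (k + 1))})
      (1 + Nat.card B * (Nat.card B * 2 ^ (Nat.card B * Nat.card B))) := by
  let S : ℕ → (ℕ → B) → Set (B × B) := fun l u => {x | ∃ k, k + 1 < l ∧ x = (u k, u (k + 1))}
  let h : ℕ → (ℕ → B) → Option (B × B × Set (B × B)) := fun l u =>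
    if l = 0 then none else some (u 0, u (l - 1), S l u)
  have hpos : ∀ l u, 0 < l → h l u = some (u 0, u (l - 1), S l u) := by
    intro l u hl
    simp only [h]
    rw [if_neg (by omega)]
  refine ⟨Option (B × B × Set (B × B)), inferInstance, h, ?_, ?_, ?_, ?_⟩
  · have := Fintype.ofFinite B
    rw [Finite.card_option, Nat.card_prod, Nat.card_prod]
    have e : Nat.card (Set (B × B)) = 2 ^ (Nat.card B * Nat.card B) := by
      rw [← Nat.card_prod, Nat.card_eq_fintype_card, Nat.card_eq_fintype_card, Fintype.card_set]
    rw [e, add_comm]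
  · intro l u v huv
    rcases Nat.eq_zero_or_pos l with rfl | hl
    · simp [h]
    · rw [hpos _ _ hl, hpos _ _ hl, huv 0 hl, huv (l - 1) (by omega)]
      have : S l u = S l v := by
        ext x
        constructor
        · rintro ⟨k, hk, rfl⟩
          exact ⟨k, hk, by rw [huv k (by omega), huv (k + 1) hk]⟩
        · rintro ⟨k, hk, rfl⟩
          exact ⟨k, hk, by rw [huv k (by omega), huv (k + 1) hk]⟩
      rw [this]
  · intro l u l' u' m m' e1 e2
    have hz : ∀ l u, h l u = none ↔ l = 0 := by
      intro l u
      rcases Nat.eq_zero_or_pos l with rfl | hl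
      · simp [h]
      · rw [hpos _ _ hl]; simp; omega
    have hl0 : l = 0 ↔ l' = 0 := by rw [← hz l u, ← hz l' u', e1]
    have hm0 : m = 0 ↔ m' = 0 := by rw [← hz m (sh l u), ← hz m' (sh l' u'), e2]
    rcases Nat.eq_zero_or_pos l with rfl | hl
    · obtain rfl := hl0.1 rfl
      have s0 : ∀ u : ℕ → B, sh 0 u = u := fun u => by funext k; simp [sh]
      simpa [s0] using e2
    rcases Nat.eq_zero_or_pos m with rfl | hm
    · obtain rfl := hm0.1 rfl
      simpa using e1
    have hl' : 0 < l' := by omega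
    have hm' : 0 < m' := by omega
    have hS : ∀ l m (u : ℕ → B), 0 < l → 0 < m →
        S (l + m) u = S l u ∪ S m (sh l u) ∪ {(u (l - 1), sh l u 0)} := by
      intro l m u hl hm
      ext x
      constructor
      · rintro ⟨k, hk, rfl⟩
        rcases lt_trichotomy (k + 1) l with h1 | h1 | h1
        · exact Or.inl (Or.inl ⟨k, h1, rfl⟩)
        · subst h1
          exact Or.inr (by simp [sh])
        · refine Or.inl (Or.inr ⟨k - l, by omega, ?_⟩)
          simp only [sh]
          rw [show l + (k - l) = k by omega, show l + (k - l + 1) = k + 1 by omega]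
      · rintro ((⟨k, hk, rfl⟩ | ⟨k, hk, rfl⟩) | hx)
        · exact ⟨k, by omega, rfl⟩
        · exact ⟨l + k, by omega, rfl⟩
        · refine ⟨l - 1, by omega, ?_⟩
          rw [Set.mem_singleton_iff] at hx
          rw [hx, show l - 1 + 1 = l by omega]
          simp [sh]
    rw [hpos _ _ hl, hpos _ _ hl'] at e1
    rw [hpos _ _ hm, hpos _ _ hm'] at e2
    rw [hpos _ _ (by omega), hpos _ _ (by omega), hS l m u hl hm, hS l' m' u' hl' hm']
    simp only [Option.some.injEq, Prod.mk.injEq] at e1 e2 ⊢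
    refine ⟨e1.1, ?_, ?_⟩
    · have := e2.2.1
      simp only [sh] at this
      rw [show l + m - 1 = l + (m - 1) by omega, show l' + m' - 1 = l' + (m' - 1) by omega, this]
    · rw [e1.2.2, e2.2.2, e1.2.1, e2.1]
  · have key : ∀ (u u' : ℕ → B) (f f' : ℕ → ℕ), StrictMono f → f 0 = 0 → StrictMono f' →
        f' 0 = 0 →
        (∀ i, h (f (i + 1) - f i) (sh (f i) u) = h (f' (i + 1) - f' i) (sh (f' i) u')) →
        u 0 = u' 0 ∧ {x | ∃ k, x = (u k, u (k + 1))} ⊆ {x | ∃ k, x = (u' k, u' (k + 1))} := by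
      intro u u' f f' hf hf0 hf' hf0' he
      have he' : ∀ i, u (f i) = u' (f' i) ∧ u (f (i + 1) - 1) = u' (f' (i + 1) - 1) ∧
          S (f (i + 1) - f i) (sh (f i) u) = S (f' (i + 1) - f' i) (sh (f' i) u') := by
        intro i
        have a := hf (Nat.lt_succ_self i)
        have a' := hf' (Nat.lt_succ_self i)
        simp only [Nat.succ_eq_add_one] at a a'
        have := he i
        rw [hpos _ _ (by omega), hpos _ _ (by omega)] at this
        simp only [Option.some.injEq, Prod.mk.injEq, sh] at this
        refine ⟨this.1, ?_, this.2.2⟩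
        have t := this.2.1
        rwa [show f i + (f (i + 1) - f i - 1) = f (i + 1) - 1 by omega,
          show f' i + (f' (i + 1) - f' i - 1) = f' (i + 1) - 1 by omega] at t
      refine ⟨by have := (he' 0).1; rwa [hf0, hf0'] at this, ?_⟩
      rintro x ⟨k, rfl⟩
      obtain ⟨i, h1, h2⟩ := idx_ex hf hf0 k
      by_cases hk : k + 1 = f (i + 1)
      · refine ⟨f' (i + 1) - 1, ?_⟩
        have a' := hf' (Nat.lt_succ_self i)
        simp only [Nat.succ_eq_add_one] at a'
        rw [show f' (i + 1) - 1 + 1 = f' (i + 1) by omega, ← (he' (i + 1)).1, ← (he' i).2.1, ← hk]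
        simp
      · have : (u k, u (k + 1)) ∈ S (f (i + 1) - f i) (sh (f i) u) := by
          refine ⟨k - f i, by omega, ?_⟩
          simp only [sh]
          rw [show f i + (k - f i) = k by omega, show f i + (k - f i + 1) = k + 1 by omega]
        rw [(he' i).2.2] at this
        obtain ⟨k', hk', e⟩ := this
        exact ⟨f' i + k', e⟩
    intro u u' f f' hf hf0 hf' hf0' he hu
    have k1 := key u u' f f' hf hf0 hf' hf0' he
    have k2 := key u' u f' f hf' hf0' hf hf0 (fun i => (he i).symm)
    rwa [← k1.1, ← Set.Subset.antisymm k1.2 k2.2]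

theorem ramsey {Q : Type} [Finite Q] (C : ℕ → ℕ → Q) :
    ∃ (g : ℕ → ℕ) (e : Q), StrictMono g ∧ 1 ≤ g 0 ∧ ∀ i, C (g i) (g (i + 1)) = e := by
  let U : Ultrafilter ℕ := Filter.hyperfilter ℕ
  have hU : ∀ n : ℕ, ∀ᶠ j in (U : Filter ℕ), n < j := by
    intro n
    have : ∀ᶠ j in Filter.cofinite, n < j := by
      rw [Nat.cofinite_eq_atTop]; exact Filter.eventually_gt_atTop n
    exact Filter.hyperfilter_le_cofinite this
  have lim : ∀ F : ℕ → Q, ∃ q, ∀ᶠ j in (U : Filter ℕ), F j = q := by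
    intro F
    obtain ⟨q, hq⟩ := Ultrafilter.eq_pure_of_finite (U.map F)
    refine ⟨q, ?_⟩
    have : {q} ∈ U.map F := by rw [hq]; exact Set.mem_singleton q
    exact this
  choose c hc using fun i => lim (C i)
  obtain ⟨e, he⟩ := lim c
  have step : ∀ i : {i : ℕ // c i = e ∧ 1 ≤ i}, ∃ j : {i : ℕ // c i = e ∧ 1 ≤ i},
      i.1 < j.1 ∧ C i.1 j.1 = e := by
    rintro ⟨i, hi, hi1⟩
    obtain ⟨j, hj⟩ := ((hc i).and (he.and (hU i))).exists
    exact ⟨⟨j, hj.2.1, by omega⟩, hj.2.2, hj.1.trans hi⟩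
  choose nx hnx using step
  obtain ⟨i0, hi0⟩ := (he.and (hU 0)).exists
  let G : ℕ → {i : ℕ // c i = e ∧ 1 ≤ i} := fun k => Nat.rec ⟨i0, hi0.1, hi0.2⟩ (fun _ x => nx x) k
  refine ⟨fun k => (G k).1, e, ?_, (G 0).2.2, fun i => (hnx (G i)).2⟩
  exact strictMono_nat_of_lt_succ (fun i => (hnx (G i)).1)

/-- `u` is ultimately periodic with preperiod `M` and period `M`. -/
def Lasso {A : Type} (M : ℕ) (u : ℕ → A) : Prop := ∀ k, M ≤ k → u (k + M) = u k

theorem Lasso.add_mul {A : Type} {M : ℕ} {u : ℕ → A} (h : Lasso M u) {k : ℕ} (hk : M ≤ k)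
    (j : ℕ) : u (k + M * j) = u k := by
  induction j with
  | zero => simp
  | succ j ih => rw [Nat.mul_succ, ← add_assoc, h _ (by omega), ih]

theorem Lasso.mul {A : Type} {M : ℕ} {u : ℕ → A} (h : Lasso M u) {d : ℕ} (hd : 0 < d) :
    Lasso (M * d) u := fun k hk =>
  h.add_mul ((Nat.le_mul_of_pos_right M hd).trans hk) d

theorem shorten {A B Q : Type} [Finite Q] {c : ℕ} (hQ : Nat.card Q ≤ c)
    (h : ℕ → (ℕ → A × B) → Q)
    (h1 : ∀ l u v, (∀ k < l, u k = v k) → h l u = h l v)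
    (h2 : ∀ l u l' u' m m', h l u = h l' u' → h m (sh l u) = h m' (sh l' u') →
      h (l + m) u = h (l' + m') u') {M : ℕ} (u : ℕ → A) (hu : Lasso M u) :
    ∀ (m : ℕ) (v : ℕ → B), 1 ≤ m → ∃ (m' : ℕ) (v' : ℕ → B), 1 ≤ m' ∧ m' ≤ c ∧
      h (M * m') (fun k => (u k, v' k)) = h (M * m) (fun k => (u k, v k)) := by
  intro m
  induction m using Nat.strong_induction_on with
  | _ m ih =>
    intro v hm
    by_cases hmc : m ≤ c
    · exact ⟨m, v, hm, hmc, rfl⟩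
    push Not at hmc
    have hni : ¬ Function.Injective
        (fun i : Fin m => h (M * (i.1 + 1)) (fun k => (u k, v k))) := by
      intro hinj
      have := Nat.card_le_card_of_injective _ hinj
      simp at this
      omega
    have : ∃ i j, i < j ∧ j < m ∧ h (M * (i + 1)) (fun k => (u k, v k)) =
        h (M * (j + 1)) (fun k => (u k, v k)) := by
      simp only [Function.Injective] at hni
      push Not at hni
      obtain ⟨⟨i, hi⟩, ⟨j, hj⟩, e, hne⟩ := hni
      rcases lt_trichotomy i j with hl | hl | hl
      · exact ⟨i, j, hl, hj, e⟩
      · exact absurd (by simp [hl]) hne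
      · exact ⟨j, i, hl, hi, e.symm⟩
    obtain ⟨i, j, hij, hjm, e⟩ := this
    let v' : ℕ → B := fun t => if t < M * (i + 1) then v t else v (t + M * (j - i))
    obtain ⟨m', v'', a1, a2, a3⟩ := ih (m - (j - i)) (by omega) v' (by omega)
    refine ⟨m', v'', a1, a2, a3.trans ?_⟩
    have e1 : M * (m - (j - i)) = M * (i + 1) + M * (m - (j + 1)) := by
      rw [← Nat.mul_add]; congr 1; omega
    have e2 : M * m = M * (j + 1) + M * (m - (j + 1)) := by
      rw [← Nat.mul_add]; congr 1; omega
    rw [e1, e2]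
    apply h2
    · rw [← e]
      exact h1 _ _ _ (fun k hk => by simp [v', hk])
    · apply h1
      intro k _
      have e3 : M * (j + 1) + k = M * (i + 1) + k + M * (j - i) := by
        have : j + 1 = (i + 1) + (j - i) := by omega
        rw [this, Nat.mul_add]; ring
      simp only [sh, v']
      rw [e3, hu.add_mul (by rw [Nat.mul_succ]; omega)]
      simp

theorem Rec.lasso {A B : Type} {P : (ℕ → A × B) → Prop} {c : ℕ} (h : Rec P c) {M : ℕ}
    (hM : 0 < M) (u : ℕ → A) (hu : Lasso M u) (hex : ∃ v : ℕ → B, P (fun k => (u k, v k))) :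
    ∃ v : ℕ → B, Lasso (M * c.factorial) v ∧ P (fun k => (u k, v k)) := by
  obtain ⟨Q, hQ, h, hc, h1, h2, h3⟩ := h
  obtain ⟨v, hv⟩ := hex
  obtain ⟨g, e, hg, hg0, hge⟩ := ramsey
    (fun i j => h (M * j - M * i) (sh (M * i) (fun k => (u k, v k))))
  obtain ⟨a, x, ha1, hac, hx⟩ := shorten hc h h1 h2 u hu (g 0) v hg0
  have hpu : ∀ j, 1 ≤ j → ∀ k, u (M * j + k) = u (M + k) := by
    intro j hj k
    obtain ⟨j, rfl⟩ : ∃ i, j = i + 1 := ⟨j - 1, by omega⟩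
    rw [← hu.add_mul (k := M + k) (by omega) j]
    congr 1; ring
  have hus : Lasso M (sh M u) := by
    intro k hk
    simp only [sh]
    rw [← add_assoc]
    exact hu _ (by omega)
  obtain ⟨b, y, hb1, hbc, hy⟩ := shorten hc h h1 h2 (sh M u) hus (g 1 - g 0) (sh (M * g 0) v)
    (by have := hg (show 0 < 1 by omega); omega)
  have hy' : h (M * b) (fun k => (sh M u k, y k)) = e := by
    rw [hy, ← hge 0]
    simp only [zero_add]
    rw [Nat.mul_sub]
    apply h1
    intro k _
    simp only [sh]
    rw [hpu _ hg0]
  have hMb : 0 < M * b := Nat.mul_pos hM hb1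
  let v' : ℕ → B := fun t => if t < M * a then x t else y ((t - M * a) % (M * b))
  refine ⟨v', ?_, ?_⟩
  · intro k hk
    have hfa : M * a ≤ M * c.factorial :=
      Nat.mul_le_mul_left M (hac.trans (Nat.self_le_factorial c))
    obtain ⟨d, hd⟩ : b ∣ c.factorial := Nat.dvd_factorial hb1 hbc
    simp only [v']
    rw [if_neg (by omega), if_neg (by omega)]
    congr 1
    rw [show k + M * c.factorial - M * a = (k - M * a) + M * b * d by
      rw [hd, mul_assoc]; rw [hd] at hfa hk; omega]
    exact Nat.add_mul_mod_self_left _ _ _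
  · let f : ℕ → ℕ := fun i => Nat.casesOn i 0 (fun j => M * g j)
    let f' : ℕ → ℕ := fun i => Nat.casesOn i 0 (fun j => M * a + M * b * j)
    refine h3 _ _ f f' ?_ rfl ?_ rfl ?_ hv
    · apply strictMono_nat_of_lt_succ
      rintro (_ | j)
      · exact Nat.mul_pos hM hg0
      · exact Nat.mul_lt_mul_of_pos_left (hg (Nat.lt_succ_self j)) hM
    · apply strictMono_nat_of_lt_succ
      rintro (_ | j)
      · have : 0 < M * a := Nat.mul_pos hM ha1
        simp only [f']; omega
      · simp only [f']
        have : M * b * (j + 1) = M * b * j + M * b := by ring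
        omega
    · rintro (_ | j)
      · change h (M * g 0 - 0) (sh 0 (fun k => (u k, v k))) =
          h (M * a + M * b * 0 - 0) (sh 0 (fun k => (u k, v' k)))
        rw [Nat.mul_zero, Nat.add_zero, Nat.sub_zero, Nat.sub_zero]
        have s0 : ∀ w : ℕ → A × B, sh 0 w = w := fun u => by funext k; simp [sh]
        rw [s0, s0, ← hx]
        exact h1 _ _ _ (fun k hk => by simp [v', hk])
      · simp only [f, f']
        refine (hge j).trans (hy'.symm.trans ?_)
        have : M * a + M * b * (j + 1) - (M * a + M * b * j) = M * b := by
          have : M * b * (j + 1) = M * b * j + M * b := by ring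
          omega
        rw [this]
        apply h1
        intro k hk
        simp only [sh, v']
        rw [if_neg (by omega)]
        congr 1
        · have e : M * a + M * b * j + k = M * (a + b * j) + k := by ring
          rw [e, hpu _ (by omega)]
        · congr 1
          rw [show M * a + M * b * j + k - M * a = k + M * b * j by omega,
            Nat.add_mul_mod_self_left, Nat.mod_eq_of_lt hk]

end HC

namespace HC

/-- Colour bound for local languages over an alphabet with `b` letters. -/
def bb (b : ℕ) : ℕ := 1 + b * (b * 2 ^ (b * b))

theorem bb_mono {a b : ℕ} (h : a ≤ b) : bb a ≤ bb b := by
  unfold bb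
  have : 2 ^ (a * a) ≤ 2 ^ (b * b) := Nat.pow_le_pow_right (by norm_num) (Nat.mul_le_mul h h)
  gcongr

theorem ex_ex_eq {X : Type} (f : ℕ → X) (p : X → Prop) :
    (∃ x, (∃ k, x = f k) ∧ p x) ↔ ∃ k, p (f k) :=
  ⟨fun ⟨_, ⟨k, hk⟩, h⟩ => ⟨k, hk ▸ h⟩, fun ⟨k, h⟩ => ⟨_, ⟨k, rfl⟩, h⟩⟩

theorem Rec.ofLoc {A B : Type} [Finite B] (g : A → B) (G : B → Set (B × B) → Prop)
    {P : (ℕ → A) → Prop} {b : ℕ} (hb : Nat.card B ≤ b)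
    (hP : ∀ u, G (g (u 0)) {x | ∃ k, x = (g (u k), g (u (k + 1)))} ↔ P u) : Rec P (bb b) :=
  (((Rec.base G).map g).congr hP).mono (bb_mono hb)

/-- Total colour bound: a tower. -/
def TG (β : ℕ) : ℕ → ℕ
  | 0 => β
  | t + 1 => 2 ^ (β * TG β t * 2 ^ (β * TG β t))

def bt (n : ℕ) : ℕ := bb (8 * n * n)

theorem bt_pos (n : ℕ) : 0 < bt n := by unfold bt bb; omega

theorem le_big {β g : ℕ} (hβ : 0 < β) : g ≤ β * g * 2 ^ (β * g) :=
  calc g ≤ β * g := Nat.le_mul_of_pos_left g hβ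
    _ ≤ β * g * 2 ^ (β * g) := Nat.le_mul_of_pos_right _ (by positivity)

theorem TG_mono {β : ℕ} (hβ : 0 < β) : Monotone (TG β) := by
  apply monotone_nat_of_le_succ
  intro t
  exact (le_big hβ).trans Nat.lt_two_pow_self.le

theorem TG_step {β : ℕ} (hβ : 0 < β) {t s : ℕ} (h : t < s) :
    2 ^ (β * TG β t * 2 ^ (β * TG β t)) ≤ TG β s :=
  TG_mono hβ (show t + 1 ≤ s from h)

/-- The unary mark of position `i`. -/
def mk (i : ℕ) : ℕ → Bool := fun k => decide (k < i)

theorem valid_iff (m : ℕ → Bool) :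
    (∃ i, ∀ k, m k = mk i k) ↔
      (∃ k, m k = false) ∧ ∀ k, ¬ (m k = false ∧ m (k + 1) = true) := by
  constructor
  · rintro ⟨i, hi⟩
    refine ⟨⟨i, by simp [hi, mk]⟩, fun k => ?_⟩
    simp only [hi, mk, decide_eq_false_iff_not, decide_eq_true_eq]
    omega
  · rintro ⟨h1, h2⟩
    classical
    refine ⟨Nat.find h1, fun k => ?_⟩
    by_cases hk : k < Nat.find h1
    · have := Nat.find_min h1 hk
      simp only [mk, hk, decide_true]
      simpa using this
    · have h3 : ∀ d, m (Nat.find h1 + d) = false := by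
        intro d
        induction d with
        | zero => exact Nat.find_spec h1
        | succ d ih =>
          have := h2 (Nat.find h1 + d)
          rw [← add_assoc]
          cases h : m (Nat.find h1 + d + 1)
          · rfl
          · exact absurd ⟨ih, h⟩ this
      have := h3 (k - Nat.find h1)
      rw [show Nat.find h1 + (k - Nat.find h1) = k by omega] at this
      simp [mk, hk, this]

theorem mk_inj {i j : ℕ} (h : ∀ k, mk i k = mk j k) : i = j := by
  have h1 := h i
  have h2 := h j
  simp [mk] at h1 h2
  omega

theorem at_iff {m : ℕ → Bool} {i : ℕ} (hm : ∀ k, m k = mk i k) (b : ℕ → Prop) :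
    ((m 0 = false ∧ b 0) ∨ ∃ k, m k = true ∧ m (k + 1) = false ∧ b (k + 1)) ↔ b i := by
  simp only [hm, mk, decide_eq_false_iff_not, decide_eq_true_eq]
  constructor
  · rintro (⟨h1, h2⟩ | ⟨k, h1, h2, h3⟩)
    · obtain rfl : i = 0 := by omega
      exact h2
    · obtain rfl : i = k + 1 := by omega
      exact h3
  · intro h
    rcases i with _ | i
    · exact Or.inl ⟨by omega, h⟩
    · exact Or.inr ⟨i, by omega, by omega, h⟩

/-- Letters of the joint words. -/
abbrev Lt (n : ℕ) : Type := (ℕ → Fin n) × Fin n × Bool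

/-- The language of a formula. -/
def Pf (K : FinKripke) (φ : HCTL) (u : ℕ → Lt K.n) : Prop :=
  ∃ i, (∀ k, (u k).2.2 = mk i k) ∧
    HCTL.Sat K (fun v k => (u k).1 v) (fun k => (u k).2.1) i φ

theorem Pf_mk {K : FinKripke} {φ : HCTL} {u : ℕ → Lt K.n} {i : ℕ}
    (h : ∀ k, (u k).2.2 = mk i k) :
    Pf K φ u ↔ HCTL.Sat K (fun v k => (u k).1 v) (fun k => (u k).2.1) i φ := by
  constructor
  · rintro ⟨j, hj, hs⟩
    obtain rfl : i = j := mk_inj (fun k => (h k).symm.trans (hj k))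
    exact hs
  · exact fun hs => ⟨i, h, hs⟩

/-- The language under the path quantifier. -/
def Pex (K : FinKripke) (π : ℕ) (φ : HCTL) (u : ℕ → Lt K.n × Fin K.n) : Prop :=
  (∃ i, (∀ k, (u k).1.2.2 = mk i k) ∧ K.PathFrom ((u i).1.2.1) (fun k => (u k).2)) ∧
    Pf K φ (fun k => (Function.update (u k).1.1 π (u k).2, (u k).2, (u k).1.2.2))

theorem card_aux (K : FinKripke) : 1 ≤ K.n * K.n := by
  have := K.init.2
  have h : 0 < K.n := by omega
  exact Nat.mul_pos h h

theorem rec_Pex (K : FinKripke) (π : ℕ) (φ : HCTL) {c : ℕ} (h : Rec (Pf K φ) c) :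
    Rec (Pex K π φ) (bt K.n * c) := by
  refine Rec.and ?_ (h.map (fun x : Lt K.n × Fin K.n =>
    ((Function.update x.1.1 π x.2, x.2, x.1.2.2) : Lt K.n)))
  refine Rec.ofLoc (B := Fin K.n × Fin K.n × Bool)
    (fun x : Lt K.n × Fin K.n => (x.2, x.1.2.1, x.1.2.2))
    (fun b X => ((∃ x ∈ X, x.1.2.2 = false) ∧
        ∀ x ∈ X, ¬ (x.1.2.2 = false ∧ x.2.2.2 = true)) ∧
      (∀ x ∈ X, x.2.1 ∈ K.trans x.1.1) ∧
      ((b.2.2 = false ∧ b.1 = b.2.1) ∨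
        ∃ x ∈ X, x.1.2.2 = true ∧ x.2.2.2 = false ∧ b.1 = x.2.2.1)) ?_ ?_
  · simp only [Nat.card_eq_fintype_card, Fintype.card_prod, Fintype.card_fin, Fintype.card_bool]
    nlinarith [card_aux K]
  · intro u
    have hv := valid_iff (fun k => (u k).1.2.2)
    simp only [Set.mem_ofPred_eq, ex_ex_eq, forall_exists_index, forall_eq_apply_imp_iff]
    rw [← hv]
    constructor
    · rintro ⟨⟨i, hi⟩, h1, h2⟩
      refine ⟨i, hi, ?_, h1⟩
      exact (at_iff hi (fun k => (u 0).2 = (u k).1.2.1)).1 h2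
    · rintro ⟨i, hi, h2, h1⟩
      exact ⟨⟨i, hi⟩, h1, (at_iff hi (fun k => (u 0).2 = (u k).1.2.1)).2 h2⟩

theorem upd_eq {K : FinKripke} (u : ℕ → ℕ → Fin K.n) (π : ℕ) (p : ℕ → Fin K.n) :
    (fun v k => Function.update (fun v => u v k) π (p k) v) = Function.update u π p := by
  funext v k
  by_cases hv : v = π
  · subst hv; simp
  · simp [Function.update_of_ne hv]

theorem Pex_iff {K : FinKripke} {π : ℕ} {φ : HCTL} {u : ℕ → Lt K.n} {p : ℕ → Fin K.n} {i : ℕ}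
    (h : ∀ k, (u k).2.2 = mk i k) :
    Pex K π φ (fun k => (u k, p k)) ↔ K.PathFrom ((u i).2.1) p ∧
      HCTL.Sat K (Function.update (fun v k => (u k).1 v) π p) p i φ := by
  unfold Pex
  rw [Pf_mk (i := i) (by simpa using h)]
  rw [← upd_eq]
  refine and_congr ?_ Iff.rfl
  constructor
  · rintro ⟨j, hj, hs⟩
    obtain rfl : i = j := mk_inj (fun k => (h k).symm.trans (hj k))
    exact hs
  · exact fun hs => ⟨i, h, hs⟩

/-- The language under the position quantifier of an until. -/
def Pun (K : FinKripke) (φ₁ φ₂ : HCTL) (u : ℕ → Lt K.n × Bool) : Prop :=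
  (∃ i k, (∀ t, (u t).1.2.2 = mk i t) ∧ (∀ t, (u t).2 = mk k t) ∧ i ≤ k) ∧
  Pf K φ₂ (fun t => ((u t).1.1, (u t).1.2.1, (u t).2)) ∧
  ¬ ∃ w : ℕ → Bool,
    (∃ i k j, (∀ t, (u t).1.2.2 = mk i t) ∧ (∀ t, (u t).2 = mk k t) ∧
      (∀ t, w t = mk j t) ∧ i ≤ j ∧ j < k) ∧
    ¬ Pf K φ₁ (fun t => ((u t).1.1, (u t).1.2.1, w t))

theorem mk_le_iff {i k : ℕ} : i ≤ k ↔ ∀ t, ¬ (mk i t = true ∧ mk k t = false) := by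
  simp only [mk, decide_eq_false_iff_not, decide_eq_true_eq]
  constructor
  · intro h t; omega
  · intro h
    have := h k
    omega

theorem rec_Pun (K : FinKripke) (φ₁ φ₂ : HCTL) {c₁ c₂ : ℕ} (h₁ : Rec (Pf K φ₁) c₁)
    (h₂ : Rec (Pf K φ₂) c₂) :
    Rec (Pun K φ₁ φ₂) (bt K.n * (c₂ * 2 ^ (bt K.n * c₁))) := by
  refine Rec.and ?_ (Rec.and (h₂.map (fun x : Lt K.n × Bool =>
    ((x.1.1, x.1.2.1, x.2) : Lt K.n))) (Rec.not ?_))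
  · refine Rec.ofLoc (B := Bool × Bool)
      (fun x : Lt K.n × Bool => (x.1.2.2, x.2))
      (fun _ X => ((∃ x ∈ X, x.1.1 = false) ∧ ∀ x ∈ X, ¬ (x.1.1 = false ∧ x.2.1 = true)) ∧
        ((∃ x ∈ X, x.1.2 = false) ∧ ∀ x ∈ X, ¬ (x.1.2 = false ∧ x.2.2 = true)) ∧
        ∀ x ∈ X, ¬ (x.1.1 = true ∧ x.1.2 = false)) ?_ ?_
    · simp only [Nat.card_eq_fintype_card, Fintype.card_prod, Fintype.card_bool]
      nlinarith [card_aux K]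
    · intro u
      have hv := valid_iff (fun k => (u k).1.2.2)
      have hw := valid_iff (fun k => (u k).2)
      simp only [Set.mem_ofPred_eq, ex_ex_eq, forall_exists_index,
        forall_eq_apply_imp_iff]
      rw [← hv, ← hw]
      constructor
      · rintro ⟨⟨i, hi⟩, ⟨k, hk⟩, h⟩
        refine ⟨i, k, hi, hk, mk_le_iff.2 ?_⟩
        simpa only [hi, hk] using h
      · rintro ⟨i, k, hi, hk, h⟩
        refine ⟨⟨i, hi⟩, ⟨k, hk⟩, ?_⟩
        simpa only [hi, hk] using mk_le_iff.1 h
  · refine Rec.proj (B := Bool) (P := fun u : ℕ → (Lt K.n × Bool) × Bool =>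
      (∃ i k j, (∀ t, (u t).1.1.2.2 = mk i t) ∧ (∀ t, (u t).1.2 = mk k t) ∧
      (∀ t, (u t).2 = mk j t) ∧ i ≤ j ∧ j < k) ∧
      ¬ Pf K φ₁ (fun t => ((u t).1.1.1, (u t).1.1.2.1, (u t).2))) ?_
    refine Rec.and ?_ (Rec.not (h₁.map (fun x : (Lt K.n × Bool) × Bool =>
      ((x.1.1.1, x.1.1.2.1, x.2) : Lt K.n))))
    refine Rec.ofLoc (B := Bool × Bool × Bool)
      (fun x : (Lt K.n × Bool) × Bool => (x.1.1.2.2, x.1.2, x.2))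
      (fun _ X => ((∃ x ∈ X, x.1.1 = false) ∧ ∀ x ∈ X, ¬ (x.1.1 = false ∧ x.2.1 = true)) ∧
        ((∃ x ∈ X, x.1.2.1 = false) ∧ ∀ x ∈ X, ¬ (x.1.2.1 = false ∧ x.2.2.1 = true)) ∧
        ((∃ x ∈ X, x.1.2.2 = false) ∧ ∀ x ∈ X, ¬ (x.1.2.2 = false ∧ x.2.2.2 = true)) ∧
        (∀ x ∈ X, ¬ (x.1.1 = true ∧ x.1.2.2 = false)) ∧
        ¬ (∀ x ∈ X, ¬ (x.1.2.1 = true ∧ x.1.2.2 = false))) ?_ ?_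
    · simp only [Nat.card_eq_fintype_card, Fintype.card_prod, Fintype.card_bool]
      nlinarith [card_aux K]
    · intro u
      have hv := valid_iff (fun k => (u k).1.1.2.2)
      have hw := valid_iff (fun k => (u k).1.2)
      have hx := valid_iff (fun k => (u k).2)
      simp only [Set.mem_ofPred_eq, ex_ex_eq, forall_exists_index,
        forall_eq_apply_imp_iff]
      rw [← hv, ← hw, ← hx]
      constructor
      · rintro ⟨⟨i, hi⟩, ⟨k, hk⟩, ⟨j, hj⟩, h, h'⟩
        simp only [hi, hk, hj] at h h'
        rw [← mk_le_iff] at h h'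
        exact ⟨i, k, j, hi, hk, hj, h, by omega⟩
      · rintro ⟨i, k, j, hi, hk, hj, h, h'⟩
        refine ⟨⟨i, hi⟩, ⟨k, hk⟩, ⟨j, hj⟩, ?_⟩
        simp only [hi, hk, hj]
        rw [← mk_le_iff, ← mk_le_iff]
        omega

theorem Pun_iff {K : FinKripke} {φ₁ φ₂ : HCTL} {u : ℕ → Lt K.n} {v : ℕ → Bool} {i : ℕ}
    (h : ∀ k, (u k).2.2 = mk i k) :
    Pun K φ₁ φ₂ (fun k => (u k, v k)) ↔ ∃ k, (∀ t, v t = mk k t) ∧ i ≤ k ∧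
      HCTL.Sat K (fun v k => (u k).1 v) (fun k => (u k).2.1) k φ₂ ∧
      ∀ j, i ≤ j → j < k → HCTL.Sat K (fun v k => (u k).1 v) (fun k => (u k).2.1) j φ₁ := by
  unfold Pun
  constructor
  · rintro ⟨⟨i', k, hi, hk, hik⟩, h2, h1⟩
    obtain rfl : i = i' := mk_inj (fun k => (h k).symm.trans (hi k))
    rw [Pf_mk (i := k) (by simpa using hk)] at h2
    refine ⟨k, hk, hik, h2, fun j hj hjk => ?_⟩
    by_contra hc
    refine h1 ⟨mk j, ⟨i, k, j, hi, hk, fun _ => rfl, hj, hjk⟩, ?_⟩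
    rwa [Pf_mk (i := j) (by simp)]
  · rintro ⟨k, hk, hik, h2, h1⟩
    refine ⟨⟨i, k, h, hk, hik⟩, ?_, ?_⟩
    · rwa [Pf_mk (i := k) (by simpa using hk)]
    · rintro ⟨w, ⟨i', k', j, hi', hk', hj, hij, hjk⟩, hn⟩
      obtain rfl : i = i' := mk_inj (fun k => (h k).symm.trans (hi' k))
      obtain rfl : k = k' := mk_inj (fun t => (hk t).symm.trans (hk' t))
      rw [Pf_mk (i := j) (by simpa using hj)] at hn
      exact hn (h1 j hij hjk)

theorem rec_valid (K : FinKripke) :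
    Rec (fun u : ℕ → Lt K.n => ∃ i, ∀ k, (u k).2.2 = mk i k) (bt K.n) := by
  refine Rec.ofLoc (B := Bool) (fun x : Lt K.n => x.2.2)
    (fun _ X => ((∃ x ∈ X, x.1 = false) ∧ ∀ x ∈ X, ¬ (x.1 = false ∧ x.2 = true))) ?_ ?_
  · simp only [Nat.card_eq_fintype_card, Fintype.card_bool]
    nlinarith [card_aux K]
  · intro u
    simp only [Set.mem_ofPred_eq, ex_ex_eq, forall_exists_index,
      forall_eq_apply_imp_iff]
    exact (valid_iff (fun k => (u k).2.2)).symm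

theorem rec_Pf (K : FinKripke) (φ : HCTL) : Rec (Pf K φ) (TG (bt K.n) φ.enc) := by
  have hβ := bt_pos K.n
  have pw : ∀ x : ℕ, x ≤ 2 ^ x := fun x => Nat.lt_two_pow_self.le
  induction φ with
  | atom a π =>
    refine Rec.mono (c := TG (bt K.n) 0) ?_ (TG_mono hβ (Nat.zero_le _))
    classical
    refine Rec.ofLoc (B := Bool × Bool) (fun x : Lt K.n => (decide (a ∈ K.label (x.1 π)), x.2.2))
      (fun b X => ((∃ x ∈ X, x.1.2 = false) ∧ ∀ x ∈ X, ¬ (x.1.2 = false ∧ x.2.2 = true)) ∧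
        ((b.2 = false ∧ b.1 = true) ∨
          ∃ x ∈ X, x.1.2 = true ∧ x.2.2 = false ∧ x.2.1 = true)) ?_ ?_
    · simp only [Nat.card_eq_fintype_card, Fintype.card_prod, Fintype.card_bool]
      nlinarith [card_aux K]
    · intro u
      have hv := valid_iff (fun k => (u k).2.2)
      simp only [Set.mem_ofPred_eq, ex_ex_eq, forall_exists_index,
        forall_eq_apply_imp_iff, decide_eq_true_eq]
      rw [← hv]
      unfold Pf
      simp only [HCTL.Sat]
      constructor
      · rintro ⟨⟨i, hi⟩, h⟩
        exact ⟨i, hi, (at_iff hi (fun k => a ∈ K.label ((u k).1 π))).1 h⟩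
      · rintro ⟨i, hi, h⟩
        exact ⟨⟨i, hi⟩, (at_iff hi (fun k => a ∈ K.label ((u k).1 π))).2 h⟩
  | not φ ih =>
    have hlt : φ.enc < (HCTL.not φ).enc := by
      have := Nat.add_le_pair 1 φ.enc
      simp only [HCTL.enc]; omega
    refine (((rec_valid K).and ih.not).congr (fun u => ?_)).mono ?_ (P := Pf K φ.not)
    · constructor
      · rintro ⟨⟨i, hi⟩, h⟩
        rw [Pf_mk hi] at h
        exact ⟨i, hi, h⟩
      · rintro ⟨i, hi, h⟩
        refine ⟨⟨i, hi⟩, ?_⟩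
        rw [Pf_mk hi]
        exact h
    · refine le_trans ?_ (TG_step hβ hlt)
      refine le_trans ?_ (pw _)
      exact Nat.le_mul_of_pos_right _ (by positivity)
  | or φ₁ φ₂ ih₁ ih₂ =>
    have h0 := Nat.add_le_pair 2 (Nat.pair φ₁.enc φ₂.enc)
    have h00 := Nat.add_le_pair φ₁.enc φ₂.enc
    have hlt : max φ₁.enc φ₂.enc < (HCTL.or φ₁ φ₂).enc := by
      simp only [HCTL.enc]; omega
    refine (((ih₁.mono (TG_mono hβ (le_max_left _ φ₂.enc))).or
      (ih₂.mono (TG_mono hβ (le_max_right φ₁.enc _)))).congr (fun u => ?_)).mono ?_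
      (P := Pf K (φ₁.or φ₂))
    · constructor
      · rintro (⟨i, hi, h⟩ | ⟨i, hi, h⟩)
        · exact ⟨i, hi, Or.inl h⟩
        · exact ⟨i, hi, Or.inr h⟩
      · rintro ⟨i, hi, h | h⟩
        · exact Or.inl ⟨i, hi, h⟩
        · exact Or.inr ⟨i, hi, h⟩
    · refine le_trans ?_ (TG_step hβ hlt)
      refine le_trans ?_ (pw _)
      refine Nat.mul_le_mul (Nat.le_mul_of_pos_left _ hβ) ?_
      exact (Nat.le_mul_of_pos_left _ hβ).trans (pw _)
  | next φ ih =>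
    have hlt : φ.enc < (HCTL.next φ).enc := by
      have := Nat.add_le_pair 3 φ.enc
      simp only [HCTL.enc]; omega
    refine ((Rec.proj (B := Bool) (P := fun u : ℕ → Lt K.n × Bool =>
      (∃ i, (∀ k, (u k).1.2.2 = mk i k) ∧ (∀ k, (u k).2 = mk (i + 1) k)) ∧
        Pf K φ (fun t => ((u t).1.1, (u t).1.2.1, (u t).2)))
      (c := bt K.n * TG (bt K.n) φ.enc) ?_).congr (fun u => ?_)).mono ?_
      (P := Pf K (φ.next))
    · refine Rec.and ?_ (ih.map (fun x : Lt K.n × Bool => ((x.1.1, x.1.2.1, x.2) : Lt K.n)))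
      refine Rec.ofLoc (B := Bool × Bool) (fun x : Lt K.n × Bool => (x.1.2.2, x.2))
        (fun b X => ((∃ x ∈ X, x.1.1 = false) ∧ ∀ x ∈ X, ¬ (x.1.1 = false ∧ x.2.1 = true)) ∧
          b.2 = true ∧ ∀ x ∈ X, x.2.2 = x.1.1) ?_ ?_
      · simp only [Nat.card_eq_fintype_card, Fintype.card_prod, Fintype.card_bool]
        nlinarith [card_aux K]
      · intro u
        have hv := valid_iff (fun k => (u k).1.2.2)
        simp only [Set.mem_ofPred_eq, ex_ex_eq, forall_exists_index,
          forall_eq_apply_imp_iff]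
        rw [← hv]
        constructor
        · rintro ⟨⟨i, hi⟩, h0, h1⟩
          refine ⟨i, hi, fun k => ?_⟩
          rcases k with _ | k
          · simp [h0, mk]
          · simp [h1, hi, mk]
        · rintro ⟨i, hi, h⟩
          refine ⟨⟨i, hi⟩, by simp [h, mk], fun k => by simp [h, hi, mk]⟩
    · constructor
      · rintro ⟨v, ⟨i, hi, hv⟩, h⟩
        rw [Pf_mk (i := i + 1) (by simpa using hv)] at h
        exact ⟨i, hi, h⟩
      · rintro ⟨i, hi, h⟩
        refine ⟨mk (i + 1), ⟨i, hi, fun _ => rfl⟩, ?_⟩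
        rw [Pf_mk (i := i + 1) (by simp)]
        exact h
    · refine le_trans ?_ (TG_step hβ hlt)
      refine Nat.pow_le_pow_right (by norm_num) ?_
      exact Nat.le_mul_of_pos_right _ (by positivity)
  | xuntil φ₁ φ₂ ih₁ ih₂ =>
    have h0 := Nat.add_le_pair 4 (Nat.pair φ₁.enc φ₂.enc)
    have h00 := Nat.add_le_pair φ₁.enc φ₂.enc
    have hlt : max φ₁.enc φ₂.enc < (HCTL.xuntil φ₁ φ₂).enc := by
      simp only [HCTL.enc]; omega
    refine ((rec_Pun K φ₁ φ₂ (ih₁.mono (TG_mono hβ (le_max_left _ φ₂.enc)))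
      (ih₂.mono (TG_mono hβ (le_max_right φ₁.enc _)))).proj.congr (fun u => ?_)).mono ?_
      (P := Pf K (φ₁.xuntil φ₂))
    · constructor
      · rintro ⟨v, hv⟩
        obtain ⟨i, _, hi, _⟩ := hv.1
        obtain ⟨k, _, hs⟩ := (Pun_iff hi).1 hv
        exact ⟨i, hi, k, hs⟩
      · rintro ⟨i, hi, k, hs⟩
        exact ⟨mk k, (Pun_iff hi).2 ⟨k, fun _ => rfl, hs⟩⟩
    · refine le_trans ?_ (TG_step hβ hlt)
      rw [mul_assoc]
  | ex π φ ih =>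
    have hlt : φ.enc < (HCTL.ex π φ).enc := by
      have h0 := Nat.add_le_pair 5 (Nat.pair π φ.enc)
      have := Nat.add_le_pair π φ.enc
      simp only [HCTL.enc]; omega
    refine ((rec_Pex K π φ ih).proj.congr (fun u => ?_)).mono ?_ (P := Pf K (φ.ex π))
    · constructor
      · rintro ⟨p, hp⟩
        obtain ⟨i, hi, _⟩ := hp.1
        exact ⟨i, hi, p, (Pex_iff hi).1 hp⟩
      · rintro ⟨i, hi, p, hp⟩
        exact ⟨p, (Pex_iff hi).2 hp⟩
    · refine le_trans ?_ (TG_step hβ hlt)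
      refine Nat.pow_le_pow_right (by norm_num) ?_
      exact Nat.le_mul_of_pos_right _ (by positivity)

/-- The joint word of an assignment. -/
def wd {n : ℕ} (Pi : ℕ → ℕ → Fin n) (cur : ℕ → Fin n) (i : ℕ) : ℕ → Lt n :=
  fun k => (fun v => Pi v k, cur k, mk i k)

theorem lasso_wd {n M : ℕ} {Pi : ℕ → ℕ → Fin n} {cur : ℕ → Fin n} (hM : 0 < M)
    (hPi : ∀ v, Lasso M (Pi v)) (hc : Lasso M cur) (i : ℕ) :
    Lasso (M * (i + 1)) (wd Pi cur i) := by
  intro k hk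
  have h1 : i < k := by
    have : i + 1 ≤ M * (i + 1) := Nat.le_mul_of_pos_left _ hM
    omega
  simp only [wd]
  refine Prod.ext (funext fun v => (hPi v).mul (Nat.succ_pos i) k hk)
    (Prod.ext (hc.mul (Nat.succ_pos i) k hk) ?_)
  simp only [mk]
  rw [decide_eq_false (by omega), decide_eq_false (by omega)]

/-- The size bound used by the algorithm. -/
def bnd (n c M i : ℕ) : ℕ := M * (i + 1) * (TG (bt n) c).factorial

theorem ex_bound {K : FinKripke} {M : ℕ} {Pi : ℕ → ℕ → Fin K.n} {cur : ℕ → Fin K.n}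
    (hM : 0 < M) (hPi : ∀ v, Lasso M (Pi v)) (hc : Lasso M cur) {i π : ℕ} {φ : HCTL}
    (hs : HCTL.Sat K Pi cur i (.ex π φ)) :
    ∃ p, Lasso (bnd K.n (HCTL.ex π φ).enc M i) p ∧ K.PathFrom (cur i) p ∧
      HCTL.Sat K (Function.update Pi π p) p i φ := by
  have hlt : φ.enc < (HCTL.ex π φ).enc := by
    have h0 := Nat.add_le_pair 5 (Nat.pair π φ.enc)
    have := Nat.add_le_pair π φ.enc
    simp only [HCTL.enc]; omega
  have hR := (rec_Pex K π φ (rec_Pf K φ)).mono (d := TG (bt K.n) (HCTL.ex π φ).enc) (by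
    refine le_trans ?_ (TG_step (bt_pos K.n) hlt)
    exact (Nat.le_mul_of_pos_right _ (by positivity)).trans Nat.lt_two_pow_self.le)
  obtain ⟨p0, hp0⟩ := hs
  have hm : ∀ k, (wd Pi cur i k).2.2 = mk i k := fun _ => rfl
  obtain ⟨p, h1, h2⟩ := hR.lasso (Nat.mul_pos hM (Nat.succ_pos i)) (wd Pi cur i)
    (lasso_wd hM hPi hc i) ⟨p0, (Pex_iff hm).2 hp0⟩
  exact ⟨p, h1, (Pex_iff hm).1 h2⟩

theorem until_bound {K : FinKripke} {M : ℕ} {Pi : ℕ → ℕ → Fin K.n} {cur : ℕ → Fin K.n}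
    (hM : 0 < M) (hPi : ∀ v, Lasso M (Pi v)) (hc : Lasso M cur) {i : ℕ} {φ₁ φ₂ : HCTL}
    (hs : HCTL.Sat K Pi cur i (.xuntil φ₁ φ₂)) :
    ∃ k, k ≤ bnd K.n (HCTL.xuntil φ₁ φ₂).enc M i ∧ i ≤ k ∧ HCTL.Sat K Pi cur k φ₂ ∧
      ∀ j, i ≤ j → j < k → HCTL.Sat K Pi cur j φ₁ := by
  have hβ := bt_pos K.n
  have h0 := Nat.add_le_pair 4 (Nat.pair φ₁.enc φ₂.enc)
  have h00 := Nat.add_le_pair φ₁.enc φ₂.enc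
  have hlt : max φ₁.enc φ₂.enc < (HCTL.xuntil φ₁ φ₂).enc := by
    simp only [HCTL.enc]; omega
  have hR := (rec_Pun K φ₁ φ₂ ((rec_Pf K φ₁).mono (TG_mono hβ (le_max_left _ φ₂.enc)))
    ((rec_Pf K φ₂).mono (TG_mono hβ (le_max_right φ₁.enc _)))).mono
      (d := TG (bt K.n) (HCTL.xuntil φ₁ φ₂).enc) (by
    refine le_trans ?_ (TG_step hβ hlt)
    rw [← mul_assoc]
    exact Nat.lt_two_pow_self.le)
  obtain ⟨k0, hk0⟩ := hs
  have hm : ∀ k, (wd Pi cur i k).2.2 = mk i k := fun _ => rfl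
  have hpos : 0 < bnd K.n (HCTL.xuntil φ₁ φ₂).enc M i :=
    Nat.mul_pos (Nat.mul_pos hM (Nat.succ_pos i)) (Nat.factorial_pos _)
  obtain ⟨v, h1, h2⟩ := hR.lasso (Nat.mul_pos hM (Nat.succ_pos i)) (wd Pi cur i)
    (lasso_wd hM hPi hc i) ⟨mk k0, (Pun_iff hm).2 ⟨k0, fun _ => rfl, hk0⟩⟩
  obtain ⟨k, hk, hs⟩ := (Pun_iff hm).1 h2
  refine ⟨k, ?_, hs⟩
  by_contra hlt
  push Not at hlt
  change Lasso (bnd K.n (HCTL.xuntil φ₁ φ₂).enc M i) v at h1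
  have h3 := h1 (k - 1) (by omega)
  rw [hk, hk] at h3
  simp only [mk] at h3
  rw [decide_eq_false (by omega), decide_eq_true (by omega)] at h3
  exact absurd h3 (by simp)

end HC

namespace HC

section Recursion

variable {X : Type} [Primcodable X] [DecidableEq X]

/-- Depth-bounded evaluation of a recursion scheme. -/
def ev (dep : X → List X) (comb : X × List Bool → Bool) : ℕ → X → Bool
  | 0, _ => false
  | d + 1, x => comb (x, (dep x).map (ev dep comb d))

/-- All arguments reached after exactly `k` calls. -/
def lev (dep : X → List X) (x : X) (k : ℕ) : List X :=
  Nat.rec [x] (fun _ l => l.flatMap dep) k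

/-- Evaluation tables, bottom-up. -/
def tab (dep : X → List X) (comb : X × List Bool → Bool) (x : X) (N : ℕ) (j : ℕ) :
    List (X × Bool) :=
  Nat.rec [] (fun j T => (lev dep x (N - j)).map
    (fun y => (y, comb (y, (dep y).map (fun z => (T.lookup z).getD false))))) j

theorem lookup_map {Y : Type} (g : X → Y) (l : List X) {y : X} (hy : y ∈ l) :
    (l.map (fun y => (y, g y))).lookup y = some (g y) := by
  induction l with
  | nil => simp at hy
  | cons a l ih =>
    by_cases h : y = a
    · subst h; simp [List.lookup]
    · have : y ∈ l := by simpa [h] using hy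
      have hb : (y == a) = false := by simpa using h
      simp only [List.map_cons, List.lookup, hb]
      exact ih this

theorem tab_spec (dep : X → List X) (comb : X × List Bool → Bool) (x : X) (N : ℕ) (j : ℕ)
    (hj : j ≤ N + 1) : ∀ y ∈ lev dep x (N + 1 - j),
      ((tab dep comb x N j).lookup y).getD false = ev dep comb j y := by
  induction j with
  | zero => intro y _; simp [tab, ev]
  | succ j ih =>
    intro y hy
    have e : N + 1 - (j + 1) = N - j := by omega
    rw [e] at hy
    change (((lev dep x (N - j)).map (fun y => (y, comb (y, (dep y).map
      (fun z => ((tab dep comb x N j).lookup z).getD false))))).lookup y).getD false = _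
    rw [lookup_map _ _ hy]
    simp only [Option.getD_some, ev]
    congr 2
    apply List.map_congr_left
    intro z hz
    apply ih (by omega)
    rw [show N + 1 - j = (N - j) + 1 by omega]
    exact List.mem_flatMap.2 ⟨y, hy, hz⟩

theorem exists_rec (dep : X → List X) (comb : X × List Bool → Bool) (rank : X → ℕ)
    (hdep : Primrec dep) (hcomb : Primrec comb) (hrank : Primrec rank)
    (hlt : ∀ x, ∀ y ∈ dep x, rank y < rank x) :
    ∃ f : X → Bool, Primrec f ∧ ∀ x, f x = comb (x, (dep x).map f) := by
  have stable : ∀ d x, rank x < d → ev dep comb d x = ev dep comb (rank x + 1) x := by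
    intro d
    induction d with
    | zero => intro x h; omega
    | succ d ih =>
      intro x h
      simp only [ev]
      congr 2
      apply List.map_congr_left
      intro y hy
      have := hlt x y hy
      have key : ∀ d', rank y < d' → d' ≤ d → ev dep comb d' y = ev dep comb (rank y + 1) y := by
        intro d' h1 h2
        rcases Nat.lt_or_ge d' d with h3 | h3
        · clear ih
          revert d'
          intro d' h1 h2 h3
          have main : ∀ m y, ∀ d', rank y < m → rank y < d' →
              ev dep comb d' y = ev dep comb (rank y + 1) y := by
            intro m
            induction m with
            | zero => intro y d' h; omega
            | succ m ihm =>
              intro y d' h1 h2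
              obtain ⟨e, rfl⟩ : ∃ e, d' = e + 1 := ⟨d' - 1, by omega⟩
              simp only [ev]
              congr 2
              apply List.map_congr_left
              intro z hz
              have := hlt y z hz
              rw [ihm z e (by omega) (by omega), ihm z (rank y) (by omega) (by omega)]
          exact main (rank y + 1) y d' (by omega) h1
        · obtain rfl : d' = d := by omega
          exact ih y h1
      rw [key d (by omega) le_rfl, key (rank x) this (by omega)]
  refine ⟨fun x => ((tab dep comb x (rank x) (rank x + 1)).lookup x).getD false, ?_, ?_⟩
  · have hlev : Primrec₂ (lev dep) := by
      unfold lev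
      refine Primrec.nat_rec (f := fun x : X => [x])
        (g := fun _ p => (p.2 : List X).flatMap dep) ?_ ?_
      · exact Primrec.list_cons.comp Primrec.id (Primrec.const [])
      · exact Primrec.list_flatMap (Primrec.snd.comp Primrec.snd) (hdep.comp Primrec.snd)
    have htab : Primrec₂ (fun (x : X) (j : ℕ) => tab dep comb x (rank x) j) := by
      unfold tab
      refine Primrec.nat_rec (f := fun _ : X => ([] : List (X × Bool)))
        (g := fun x p => (lev dep x (rank x - p.1)).map
          (fun y => (y, comb (y, (dep y).map
            (fun z => ((p.2 : List (X × Bool)).lookup z).getD false))))) ?_ ?_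
      · exact Primrec.const []
      · refine Primrec.list_map ?_ ?_
        · exact hlev.comp Primrec.fst (Primrec.nat_sub.comp (hrank.comp Primrec.fst)
            (Primrec.fst.comp Primrec.snd))
        · refine Primrec.pair Primrec.snd (hcomb.comp (Primrec.pair Primrec.snd ?_))
          refine Primrec.list_map (hdep.comp Primrec.snd) ?_
          refine Primrec.option_getD.comp ?_ (Primrec.const false)
          exact Primrec.listLookup.comp Primrec.snd
            (Primrec.snd.comp (Primrec.snd.comp (Primrec.fst.comp Primrec.fst)))
    refine Primrec.option_getD.comp ?_ (Primrec.const false)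
    exact Primrec.listLookup.comp Primrec.id
      (htab.comp Primrec.id (Primrec.succ.comp hrank))
  · have hf : ∀ x, ((tab dep comb x (rank x) (rank x + 1)).lookup x).getD false =
        ev dep comb (rank x + 1) x := by
      intro x
      apply tab_spec _ _ _ _ _ le_rfl
      simp [lev]
    intro x
    simp only [hf]
    rw [ev]
    congr 2
    apply List.map_congr_left
    intro y hy
    exact stable _ _ (hlt x y hy)

end Recursion

/-- Ultimately periodic path given by a list. -/
def rd (w : List ℕ) (i : ℕ) : ℕ :=
  if i < w.length / 2 then w.getD i 0 else w.getD (w.length / 2 + i % (w.length / 2)) 0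

def allL (n k : ℕ) : List (List ℕ) :=
  Nat.rec [[]] (fun _ L => L.flatMap (fun l => (List.range n).map (fun s => s :: l))) k

theorem mem_allL {n k : ℕ} {w : List ℕ} : w ∈ allL n k ↔ w.length = k ∧ ∀ s ∈ w, s < n := by
  induction k generalizing w with
  | zero =>
    change w ∈ [[]] ↔ _
    rw [List.mem_singleton]
    constructor
    · rintro rfl; simp
    · rintro ⟨h, _⟩; exact List.length_eq_zero_iff.1 h
  | succ k ih =>
    change w ∈ (allL n k).flatMap (fun l => (List.range n).map (fun s => s :: l)) ↔ _
    simp only [List.mem_flatMap, List.mem_map, List.mem_range]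
    constructor
    · rintro ⟨l, hl, s, hs, rfl⟩
      obtain ⟨h1, h2⟩ := ih.1 hl
      simp only [List.length_cons, List.mem_cons]
      refine ⟨by omega, ?_⟩
      rintro t (rfl | ht)
      · exact hs
      · exact h2 t ht
    · rintro ⟨h1, h2⟩
      rcases w with _ | ⟨s, l⟩
      · simp at h1
      · exact ⟨l, ih.2 ⟨by simpa using h1, fun t ht => h2 t (List.mem_cons_of_mem _ ht)⟩, s,
          h2 s (List.mem_cons_self), rfl⟩

/-- Structure data: `((n, init), transitions, labels)`. -/
abbrev KD : Type := (ℕ × ℕ) × List (List ℕ) × List (List ℕ)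
/-- Evaluation problems: structure, `(formula code, M)`, environment, current path, position. -/
abbrev St : Type := KD × (ℕ × ℕ) × List (ℕ × List ℕ) × List ℕ × ℕ

def vld (tr : List (List ℕ)) (s : ℕ) (w : List ℕ) : Prop :=
  rd w 0 = s ∧ ∀ k < w.length, rd w (k + 1) ∈ tr.getD (rd w k) []

instance (tr : List (List ℕ)) (s : ℕ) (w : List ℕ) : Decidable (vld tr s w) := by
  unfold vld; infer_instance

def bx (x : St) : ℕ := bnd x.1.1.1 x.2.1.1 x.2.1.2 x.2.2.2.2
def tg (x : St) : ℕ := (Nat.unpair x.2.1.1).1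
def r0 (x : St) : ℕ := (Nat.unpair x.2.1.1).2
def r1 (x : St) : ℕ := (Nat.unpair (r0 x)).1
def r2 (x : St) : ℕ := (Nat.unpair (r0 x)).2
/-- Replace formula code and position. -/
def upd (x : St) (c i : ℕ) : St := (x.1, (c, x.2.1.2), x.2.2.1, x.2.2.2.1, i)
/-- Enter a quantifier. -/
def ent (x : St) (w : List ℕ) : St := (x.1, (r2 x, bx x), (r1 x, w) :: x.2.2.1, w, x.2.2.2.2)

def dep (x : St) : List St :=
  if tg x = 1 then [upd x (r0 x) x.2.2.2.2]
  else if tg x = 2 then [upd x (r1 x) x.2.2.2.2, upd x (r2 x) x.2.2.2.2]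
  else if tg x = 3 then [upd x (r0 x) (x.2.2.2.2 + 1)]
  else if tg x = 4 then
    (List.range (bx x + 1)).map (upd x (r1 x)) ++ (List.range (bx x + 1)).map (upd x (r2 x))
  else if tg x = 5 then
    ((allL x.1.1.1 (2 * bx x)).filter
      (fun w => decide (vld x.1.2.1 (rd x.2.2.2.1 x.2.2.2.2) w))).map (ent x)
  else []

def lk (x : St) : List ℕ := (List.lookup (r2 x) x.2.2.1).getD [x.1.1.2, x.1.1.2]

def UP (x : St) (bs : List Bool) : Prop :=
  ∃ k < bx x + 1, x.2.2.2.2 ≤ k ∧ bs.getD (bx x + 1 + k) false = true ∧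
    ∀ j < k, j < x.2.2.2.2 ∨ bs.getD j false = true

instance (x : St) (bs : List Bool) : Decidable (UP x bs) := by unfold UP; infer_instance

def comb (p : St × List Bool) : Bool :=
  if tg p.1 = 0 then decide (r1 p.1 ∈ p.1.1.2.2.getD (rd (lk p.1) p.1.2.2.2.2) [])
  else if tg p.1 = 1 then !(p.2.getD 0 false)
  else if tg p.1 = 2 then p.2.getD 0 false || p.2.getD 1 false
  else if tg p.1 = 3 then p.2.getD 0 false
  else if tg p.1 = 4 then decide (UP p.1 p.2)
  else decide (true ∈ p.2)

section Prim
open Primrec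

variable {α : Type} [Primcodable α]

theorem prim_pow : Primrec₂ ((· ^ ·) : ℕ → ℕ → ℕ) :=
  Primrec₂.unpaired'.1 Nat.Primrec.pow

theorem prim_fact : Primrec Nat.factorial := by
  have h : Primrec (fun n : ℕ => (Nat.rec 1 (fun k r => (k + 1) * r) n : ℕ)) :=
    Primrec.nat_rec₁ 1 (Primrec.nat_mul.comp (Primrec.succ.comp Primrec.fst) Primrec.snd)
  refine h.of_eq (fun n => ?_)
  induction n with
  | zero => rfl
  | succ n ih => rw [Nat.factorial_succ, ← ih]

theorem prim_bt : Primrec bt := by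
  unfold bt bb
  have h : Primrec (fun n : ℕ => 8 * n * n) := nat_mul.comp (nat_mul.comp (.const 8) .id) .id
  exact nat_add.comp (.const 1) (nat_mul.comp h (nat_mul.comp h
    (prim_pow.comp (.const 2) (nat_mul.comp h h))))

theorem prim_TG : Primrec₂ TG := by
  have h : Primrec₂ (fun (β t : ℕ) =>
      (Nat.rec β (fun _ r => 2 ^ (β * r * 2 ^ (β * r))) t : ℕ)) := by
    refine Primrec.nat_rec (f := fun β : ℕ => β)
      (g := fun β p => 2 ^ (β * p.2 * 2 ^ (β * p.2))) .id ?_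
    have hb : Primrec (fun q : ℕ × ℕ × ℕ => q.1 * q.2.2) :=
      nat_mul.comp .fst (Primrec.snd.comp .snd)
    exact prim_pow.comp (.const 2) (nat_mul.comp hb (prim_pow.comp (.const 2) hb))
  refine h.of_eq (fun β t => ?_)
  induction t with
  | zero => rfl
  | succ t ih => simp only [TG, ← ih]

theorem prim_bx : Primrec bx := by
  unfold bx bnd
  have hi : Primrec (fun x : St => x.2.2.2.2) :=
    Primrec.snd.comp (Primrec.snd.comp (Primrec.snd.comp .snd))
  have hM : Primrec (fun x : St => x.2.1.2) := Primrec.snd.comp (Primrec.fst.comp .snd)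
  have hc : Primrec (fun x : St => x.2.1.1) := Primrec.fst.comp (Primrec.fst.comp .snd)
  have hn : Primrec (fun x : St => x.1.1.1) := Primrec.fst.comp (Primrec.fst.comp .fst)
  exact nat_mul.comp (nat_mul.comp hM (succ.comp hi))
    (prim_fact.comp (prim_TG.comp (prim_bt.comp hn) hc))

theorem prim_c : Primrec (fun x : St => x.2.1.1) := Primrec.fst.comp (Primrec.fst.comp .snd)
theorem prim_i : Primrec (fun x : St => x.2.2.2.2) :=
  Primrec.snd.comp (Primrec.snd.comp (Primrec.snd.comp .snd))
theorem prim_cur : Primrec (fun x : St => x.2.2.2.1) :=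
  Primrec.fst.comp (Primrec.snd.comp (Primrec.snd.comp .snd))
theorem prim_E : Primrec (fun x : St => x.2.2.1) :=
  Primrec.fst.comp (Primrec.snd.comp .snd)
theorem prim_tg : Primrec tg := Primrec.fst.comp (Primrec.unpair.comp prim_c)
theorem prim_r0 : Primrec r0 := Primrec.snd.comp (Primrec.unpair.comp prim_c)
theorem prim_r1 : Primrec r1 := Primrec.fst.comp (Primrec.unpair.comp prim_r0)
theorem prim_r2 : Primrec r2 := Primrec.snd.comp (Primrec.unpair.comp prim_r0)

theorem prim_upd {f : α → St} {g h : α → ℕ} (hf : Primrec f) (hg : Primrec g) (hh : Primrec h) :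
    Primrec (fun a => upd (f a) (g a) (h a)) := by
  unfold upd
  refine Primrec.pair (Primrec.fst.comp hf) (Primrec.pair (Primrec.pair hg ?_)
    (Primrec.pair (prim_E.comp hf) (Primrec.pair (prim_cur.comp hf) hh)))
  exact Primrec.snd.comp (Primrec.fst.comp (Primrec.snd.comp hf))

theorem prim_ent : Primrec₂ ent := by
  unfold ent
  refine Primrec.pair (Primrec.fst.comp .fst) (Primrec.pair (Primrec.pair (prim_r2.comp .fst)
    (prim_bx.comp .fst)) (Primrec.pair ?_ (Primrec.pair .snd (prim_i.comp .fst))))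
  exact list_cons.comp (Primrec.pair (prim_r1.comp .fst) .snd) (prim_E.comp .fst)

theorem prim_rd : Primrec₂ rd := by
  unfold rd
  have hl : Primrec (fun p : List ℕ × ℕ => p.1.length / 2) :=
    nat_div.comp (list_length.comp .fst) (.const 2)
  refine Primrec.ite (nat_lt.comp .snd hl) ((list_getD 0).comp .fst .snd) ?_
  exact (list_getD 0).comp .fst (nat_add.comp hl (nat_mod.comp .snd hl))

theorem prim_allL : Primrec₂ allL := by
  unfold allL
  refine Primrec.nat_rec (f := fun _ : ℕ => ([[]] : List (List ℕ)))
    (g := fun n p => (p.2 : List (List ℕ)).flatMap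
      (fun l => (List.range n).map (fun s => s :: l))) (.const _) ?_
  refine list_flatMap (Primrec.snd.comp .snd) ?_
  refine list_map (list_range.comp (Primrec.fst.comp .fst)) ?_
  exact list_cons.comp .snd (Primrec.snd.comp .fst)

theorem prim_mem {X : Type} [Primcodable X] [DecidableEq X] :
    PrimrecRel (fun (a : X) (l : List X) => a ∈ l) := by
  have h : PrimrecRel (fun (l : List X) (b : X) => ∃ a ∈ l, a = b) :=
    PrimrecRel.exists_mem_list (R := fun a b : X => a = b) Primrec.eq
  have h2 : PrimrecPred (fun p : X × List X => ∃ a ∈ p.2, a = p.1) := h.comp .snd .fst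
  exact h2.of_eq (fun p => by simp)

theorem prim_forall_lt {X : Type} [Primcodable X] {R : ℕ → X → Prop} (h : PrimrecRel R)
    {f : X → ℕ} (hf : Primrec f) : PrimrecPred (fun x => ∀ k < f x, R k x) := by
  have h1 : PrimrecRel (fun (l : List ℕ) (x : X) => ∀ k ∈ l, R k x) :=
    PrimrecRel.forall_mem_list h
  have h2 : PrimrecPred (fun x => ∀ k ∈ List.range (f x), R k x) :=
    h1.comp (f := fun x => List.range (f x)) (g := fun x : X => x) (list_range.comp hf) Primrec.id
  exact h2.of_eq (fun x => by simp only [List.mem_range])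

theorem prim_exists_lt {X : Type} [Primcodable X] {R : ℕ → X → Prop} (h : PrimrecRel R)
    {f : X → ℕ} (hf : Primrec f) : PrimrecPred (fun x => ∃ k < f x, R k x) := by
  have h1 : PrimrecRel (fun (l : List ℕ) (x : X) => ∃ k ∈ l, R k x) :=
    PrimrecRel.exists_mem_list h
  have h2 : PrimrecPred (fun x => ∃ k ∈ List.range (f x), R k x) :=
    h1.comp (f := fun x => List.range (f x)) (g := fun x : X => x) (list_range.comp hf) Primrec.id
  exact h2.of_eq (fun x => by simp only [List.mem_range])

theorem prim_vld : PrimrecPred (fun p : (List (List ℕ) × ℕ) × List ℕ => vld p.1.1 p.1.2 p.2) := by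
  unfold vld
  refine PrimrecPred.and (Primrec.eq.comp (prim_rd.comp .snd (.const 0))
    (Primrec.snd.comp .fst)) ?_
  have h : PrimrecRel (fun (k : ℕ) (p : (List (List ℕ) × ℕ) × List ℕ) =>
      rd p.2 (k + 1) ∈ p.1.1.getD (rd p.2 k) []) := by
    refine prim_mem.comp (prim_rd.comp (Primrec.snd.comp .snd) (succ.comp .fst)) ?_
    exact (list_getD []).comp (Primrec.fst.comp (Primrec.fst.comp .snd))
      (prim_rd.comp (Primrec.snd.comp .snd) .fst)
  exact prim_forall_lt h (f := fun p => p.2.length) (list_length.comp .snd)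

theorem prim_dep : Primrec dep := by
  unfold dep
  have ht : ∀ k, PrimrecPred (fun x : St => tg x = k) := fun k =>
    Primrec.eq.comp prim_tg (.const k)
  have hnil : Primrec (fun _ : St => ([] : List St)) := .const []
  have hmap : ∀ {r : St → ℕ}, Primrec r →
      Primrec (fun x : St => (List.range (bx x + 1)).map (upd x (r x))) := by
    intro r hr
    refine list_map (list_range.comp (succ.comp prim_bx)) ?_
    exact prim_upd .fst (hr.comp .fst) .snd
  refine Primrec.ite (ht 1) (list_cons.comp (prim_upd .id prim_r0 prim_i) hnil) ?_
  refine Primrec.ite (ht 2) (list_cons.comp (prim_upd .id prim_r1 prim_i)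
    (list_cons.comp (prim_upd .id prim_r2 prim_i) hnil)) ?_
  refine Primrec.ite (ht 3) (list_cons.comp (prim_upd .id prim_r0 (succ.comp prim_i)) hnil) ?_
  refine Primrec.ite (ht 4) (list_append.comp (hmap prim_r1) (hmap prim_r2)) ?_
  refine Primrec.ite (ht 5) ?_ hnil
  refine list_map ?_ prim_ent
  have h : PrimrecRel (fun (w : List ℕ) (q : List (List ℕ) × ℕ) => vld q.1 q.2 w) :=
    prim_vld.comp (Primrec.pair .snd .fst)
  have h2 := h.listFilter
  refine h2.comp (prim_allL.comp (Primrec.fst.comp (Primrec.fst.comp .fst))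
    (nat_mul.comp (.const 2) prim_bx)) (Primrec.pair (Primrec.fst.comp (Primrec.snd.comp .fst))
      (prim_rd.comp prim_cur prim_i))

theorem prim_lk : Primrec lk := by
  unfold lk
  have h : Primrec (fun x : St => x.1.1.2) := Primrec.snd.comp (Primrec.fst.comp .fst)
  exact option_getD.comp (listLookup.comp prim_r2 prim_E)
    (list_cons.comp h (list_cons.comp h (.const [])))

theorem prim_UP : PrimrecPred (fun p : St × List Bool => UP p.1 p.2) := by
  have hB : Primrec (fun p : St × List Bool => bx p.1 + 1) := succ.comp (prim_bx.comp .fst)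
  have hi : Primrec (fun p : St × List Bool => p.1.2.2.2.2) := prim_i.comp .fst
  have hget : PrimrecRel (fun (j : ℕ) (l : List Bool) => l.getD j false = true) :=
    Primrec.eq.comp ((list_getD false).comp .snd .fst) (.const true)
  have h1 : PrimrecRel (fun (j : ℕ) (q : ℕ × St × List Bool) =>
      j < q.2.1.2.2.2.2 ∨ q.2.2.getD j false = true) :=
    PrimrecPred.or (nat_lt.comp .fst (hi.comp (Primrec.snd.comp .snd)))
      (hget.comp .fst (Primrec.snd.comp (Primrec.snd.comp .snd)))
  have h3 : PrimrecPred (fun q : ℕ × St × List Bool => ∀ j < q.1,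
      j < q.2.1.2.2.2.2 ∨ q.2.2.getD j false = true) := prim_forall_lt h1 .fst
  have h4 : PrimrecPred (fun q : ℕ × St × List Bool => q.2.1.2.2.2.2 ≤ q.1) :=
    nat_le.comp (hi.comp .snd) .fst
  have h5 : PrimrecPred (fun q : ℕ × St × List Bool =>
      q.2.2.getD (bx q.2.1 + 1 + q.1) false = true) :=
    hget.comp (nat_add.comp (hB.comp .snd) .fst) (Primrec.snd.comp .snd)
  have h2 : PrimrecRel (fun (k : ℕ) (p : St × List Bool) =>
      p.1.2.2.2.2 ≤ k ∧ p.2.getD (bx p.1 + 1 + k) false = true ∧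
      ∀ j < k, j < p.1.2.2.2.2 ∨ p.2.getD j false = true) := h4.and (h5.and h3)
  exact prim_exists_lt h2 hB

theorem prim_comb : Primrec comb := by
  unfold comb
  have ht : ∀ k, PrimrecPred (fun p : St × List Bool => tg p.1 = k) := fun k =>
    Primrec.eq.comp (prim_tg.comp .fst) (.const k)
  have hget : ∀ j, Primrec (fun p : St × List Bool => p.2.getD j false) := fun j =>
    (list_getD false).comp .snd (.const j)
  refine Primrec.ite (ht 0) ?_ (Primrec.ite (ht 1) (Primrec.not.comp (hget 0))
    (Primrec.ite (ht 2) (Primrec.or.comp (hget 0) (hget 1)) (Primrec.ite (ht 3) (hget 0)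
      (Primrec.ite (ht 4) ?_ ?_))))
  · refine PrimrecPred.decide ?_
    refine prim_mem.comp (prim_r1.comp .fst) ?_
    exact (list_getD []).comp (Primrec.snd.comp (Primrec.snd.comp (Primrec.fst.comp .fst)))
      (prim_rd.comp (prim_lk.comp .fst) (prim_i.comp .fst))
  · exact PrimrecPred.decide prim_UP
  · exact PrimrecPred.decide (prim_mem.comp (.const true) .snd)

end Prim

theorem dep_lt (x : St) : ∀ y ∈ dep x, y.2.1.1 < x.2.1.1 := by
  have h0 : 1 ≤ tg x → r0 x < x.2.1.1 := by
    intro h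
    have := Nat.add_le_pair (Nat.unpair x.2.1.1).1 (Nat.unpair x.2.1.1).2
    rw [Nat.pair_unpair] at this
    unfold tg at h
    unfold r0
    omega
  have h1 : r1 x ≤ r0 x := Nat.unpair_left_le _
  have h2 : r2 x ≤ r0 x := Nat.unpair_right_le _
  intro y hy
  unfold dep at hy
  split_ifs at hy with t1 t2 t3 t4 t5
  · simp only [List.mem_singleton] at hy
    subst hy
    exact h0 (by omega)
  · have := h0 (by omega)
    simp only [List.mem_cons, List.not_mem_nil, or_false] at hy
    rcases hy with rfl | rfl <;> simp only [upd] <;> omega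
  · simp only [List.mem_singleton] at hy
    subst hy
    exact h0 (by omega)
  · have := h0 (by omega)
    simp only [List.mem_append, List.mem_map] at hy
    rcases hy with ⟨k, _, rfl⟩ | ⟨k, _, rfl⟩ <;> simp only [upd] <;> omega
  · have := h0 (by omega)
    simp only [List.mem_map] at hy
    obtain ⟨w, _, rfl⟩ := hy
    simp only [ent]
    omega
  · simp at hy

theorem exists_eval : ∃ f : St → Bool, Primrec f ∧ ∀ x, f x = comb (x, (dep x).map f) :=
  haveI : DecidableEq St := Classical.decEq _
  exists_rec dep comb (fun x => x.2.1.1) prim_dep prim_comb prim_c dep_lt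

end HC

namespace HC

def kd (K : FinKripke) : KD :=
  ((K.n, K.init.val), (List.finRange K.n).map (fun s => ((K.trans s).sort (· ≤ ·)).map Fin.val),
    (List.finRange K.n).map (fun s => (K.label s).sort (· ≤ ·)))

theorem getD_finRange {n : ℕ} {Y : Type} (g : Fin n → Y) (d : Y) (s : Fin n) :
    ((List.finRange n).map g).getD s.val d = g s := by
  rw [List.getD_eq_getElem _ _ (by simp)]
  simp

theorem mem_tr (K : FinKripke) (s t : Fin K.n) :
    t.val ∈ (kd K).2.1.getD s.val [] ↔ t ∈ K.trans s := by
  simp only [kd]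
  rw [getD_finRange]
  simp only [List.mem_map, Finset.mem_sort]
  constructor
  · rintro ⟨t', h, e⟩
    rwa [← Fin.ext e]
  · intro h
    exact ⟨t, h, rfl⟩

theorem mem_lb (K : FinKripke) (s : Fin K.n) (a : ℕ) :
    a ∈ (kd K).2.2.getD s.val [] ↔ a ∈ K.label s := by
  simp only [kd]
  rw [getD_finRange, Finset.mem_sort]

theorem rd_eq {w : List ℕ} {M : ℕ} (hw : w.length = 2 * M) (i : ℕ) :
    rd w i = if i < M then w.getD i 0 else w.getD (M + i % M) 0 := by
  unfold rd
  rw [hw, Nat.mul_div_cancel_left M (by norm_num)]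

theorem rd_lasso {w : List ℕ} {M : ℕ} (hw : w.length = 2 * M) : Lasso M (rd w) := by
  intro k hk
  rw [rd_eq hw, rd_eq hw, if_neg (by omega), if_neg (by omega), Nat.add_mod_right]

theorem rd_lt {w : List ℕ} {M n : ℕ} (hM : 0 < M) (hw : w.length = 2 * M) (h : ∀ s ∈ w, s < n)
    (i : ℕ) : rd w i < n := by
  have key : ∀ j, j < 2 * M → w.getD j 0 < n := by
    intro j hj
    rw [List.getD_eq_getElem _ _ (by omega)]
    exact h _ (List.getElem_mem _)
  rw [rd_eq hw]
  have := Nat.mod_lt i hM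
  split_ifs with h1
  · exact key _ (by omega)
  · exact key _ (by omega)

theorem rd_path {n M : ℕ} (hM : 0 < M) {p : ℕ → Fin n} (hp : Lasso M p) (k : ℕ) :
    rd ((List.range (2 * M)).map (fun k => (p k).val)) k = (p k).val := by
  have hw : ((List.range (2 * M)).map (fun k => (p k).val)).length = 2 * M := by simp
  have key : ∀ j, j < 2 * M →
      ((List.range (2 * M)).map (fun k => (p k).val)).getD j 0 = (p j).val := by
    intro j hj
    rw [List.getD_eq_getElem _ _ (by omega)]
    simp
  rw [rd_eq hw]
  have hmod := Nat.mod_lt k hM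
  split_ifs with h1
  · exact key _ (by omega)
  · rw [key _ (by omega)]
    have hdiv : 0 < k / M := Nat.div_pos (by omega) hM
    obtain ⟨q, hq⟩ : ∃ q, k / M = q + 1 := ⟨k / M - 1, by omega⟩
    have e : M + k % M + M * q = k := by
      have := Nat.mod_add_div k M
      rw [hq, Nat.mul_succ] at this
      omega
    rw [← hp.add_mul (k := M + k % M) (by omega) q, e]

theorem lasso_val {n M : ℕ} {p : ℕ → Fin n} {g : ℕ → ℕ} (h : Lasso M g)
    (hg : ∀ k, (p k).val = g k) : Lasso M p := by
  intro k hk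
  apply Fin.ext
  rw [hg, hg, h k hk]

theorem path_of_vld {K : FinKripke} {w : List ℕ} {M : ℕ} (hM : 0 < M) (hw : w.length = 2 * M)
    {p : ℕ → Fin K.n} (hp : ∀ k, (p k).val = rd w k) {s : Fin K.n}
    (hv : vld (kd K).2.1 s.val w) : K.PathFrom s p := by
  obtain ⟨h0, h1⟩ := hv
  refine ⟨Fin.ext (by rw [hp, h0]), ?_⟩
  have hl := lasso_val (rd_lasso hw) hp
  intro k
  induction k using Nat.strong_induction_on with
  | _ k ih =>
    by_cases hk : k < 2 * M
    · have := h1 k (by omega)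
      rwa [← hp, ← hp, mem_tr] at this
    · have := ih (k - M) (by omega)
      have e1 := hl (k - M) (by omega)
      have e2 := hl (k - M + 1) (by omega)
      rw [show k - M + M = k by omega] at e1
      rw [show k - M + 1 + M = k + 1 by omega] at e2
      rwa [e1, e2]

theorem vld_of_path {K : FinKripke} {w : List ℕ} 
    {p : ℕ → Fin K.n} (hp : ∀ k, (p k).val = rd w k) {s : Fin K.n}
    (h : K.PathFrom s p) : vld (kd K).2.1 s.val w := by
  refine ⟨by rw [← hp, h.1], fun k _ => ?_⟩
  rw [← hp, ← hp, mem_tr]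
  exact h.2 k

theorem bnd_pos {n c M i : ℕ} (hM : 0 < M) : 0 < bnd n c M i :=
  Nat.mul_pos (Nat.mul_pos hM (Nat.succ_pos i)) (Nat.factorial_pos _)

theorem Lasso.bnd {A : Type} {M : ℕ} {u : ℕ → A} (h : Lasso M u) (n c i : ℕ) :
    Lasso (HC.bnd n c M i) u := by
  unfold HC.bnd
  rw [Nat.mul_assoc]
  exact h.mul (Nat.mul_pos (Nat.succ_pos i) (Nat.factorial_pos _))

theorem eval_correct (f : St → Bool) (hf : ∀ x, f x = comb (x, (dep x).map f)) (K : FinKripke)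
    (φ : HCTL) : ∀ (M : ℕ) (E : List (ℕ × List ℕ)) (cur : List ℕ) (i : ℕ)
      (Pi : ℕ → ℕ → Fin K.n) (curF : ℕ → Fin K.n), 0 < M → (∀ v, Lasso M (Pi v)) → Lasso M curF →
      (∀ v k, (Pi v k).val = rd ((List.lookup v E).getD [K.init.val, K.init.val]) k) →
      (∀ k, (curF k).val = rd cur k) →
      (f (kd K, (φ.enc, M), E, cur, i) = true ↔ HCTL.Sat K Pi curF i φ) := by
  induction φ with
  | atom a π =>
    intro M E cur i Pi curF hM hPi hc hE hcur
    rw [hf]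
    have e0 : tg (kd K, ((HCTL.atom a π).enc, M), E, cur, i) = 0 := by simp [tg, HCTL.enc]
    have e1 : r1 (kd K, ((HCTL.atom a π).enc, M), E, cur, i) = a := by simp [r1, r0, HCTL.enc]
    have e2 : r2 (kd K, ((HCTL.atom a π).enc, M), E, cur, i) = π := by simp [r2, r0, HCTL.enc]
    have e3 : rd (lk (kd K, ((HCTL.atom a π).enc, M), E, cur, i)) i = (Pi π i).val := by
      unfold lk
      rw [e2, hE]
      rfl
    unfold comb
    simp only [e0, e1, e3, if_true, decide_eq_true_eq]
    rw [mem_lb]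
    rfl
  | not φ ih =>
    intro M E cur i Pi curF hM hPi hc hE hcur
    rw [hf]
    have e0 : tg (kd K, ((HCTL.not φ).enc, M), E, cur, i) = 1 := by simp [tg, HCTL.enc]
    have e1 : r0 (kd K, ((HCTL.not φ).enc, M), E, cur, i) = φ.enc := by simp [r0, HCTL.enc]
    have := ih M E cur i Pi curF hM hPi hc hE hcur
    unfold comb dep
    simp only [e0, e1, upd, HCTL.Sat]
    rw [← this]
    simp
  | or φ₁ φ₂ ih₁ ih₂ =>
    intro M E cur i Pi curF hM hPi hc hE hcur
    rw [hf]
    have e0 : tg (kd K, ((HCTL.or φ₁ φ₂).enc, M), E, cur, i) = 2 := by simp [tg, HCTL.enc]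
    have e1 : r1 (kd K, ((HCTL.or φ₁ φ₂).enc, M), E, cur, i) = φ₁.enc := by
      simp [r1, r0, HCTL.enc]
    have e2 : r2 (kd K, ((HCTL.or φ₁ φ₂).enc, M), E, cur, i) = φ₂.enc := by
      simp [r2, r0, HCTL.enc]
    have h1 := ih₁ M E cur i Pi curF hM hPi hc hE hcur
    have h2 := ih₂ M E cur i Pi curF hM hPi hc hE hcur
    unfold comb dep
    simp only [e0, e1, e2, upd, HCTL.Sat]
    rw [← h1, ← h2]
    simp
  | next φ ih =>
    intro M E cur i Pi curF hM hPi hc hE hcur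
    rw [hf]
    have e0 : tg (kd K, ((HCTL.next φ).enc, M), E, cur, i) = 3 := by simp [tg, HCTL.enc]
    have e1 : r0 (kd K, ((HCTL.next φ).enc, M), E, cur, i) = φ.enc := by simp [r0, HCTL.enc]
    have := ih M E cur (i + 1) Pi curF hM hPi hc hE hcur
    unfold comb dep
    simp only [e0, e1, upd, HCTL.Sat]
    rw [← this]
    simp
  | xuntil φ₁ φ₂ ih₁ ih₂ =>
    intro M E cur i Pi curF hM hPi hc hE hcur
    rw [hf]
    have e0 : tg (kd K, ((HCTL.xuntil φ₁ φ₂).enc, M), E, cur, i) = 4 := by simp [tg, HCTL.enc]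
    have e1 : r1 (kd K, ((HCTL.xuntil φ₁ φ₂).enc, M), E, cur, i) = φ₁.enc := by
      simp [r1, r0, HCTL.enc]
    have e2 : r2 (kd K, ((HCTL.xuntil φ₁ φ₂).enc, M), E, cur, i) = φ₂.enc := by
      simp [r2, r0, HCTL.enc]
    have h1 := fun j => ih₁ M E cur j Pi curF hM hPi hc hE hcur
    have h2 := fun j => ih₂ M E cur j Pi curF hM hPi hc hE hcur
    have eB : bx (kd K, ((HCTL.xuntil φ₁ φ₂).enc, M), E, cur, i) =
      bnd K.n (HCTL.xuntil φ₁ φ₂).enc M i := rfl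
    have hub := until_bound (K := K) (φ₁ := φ₁) (φ₂ := φ₂) (i := i) hM hPi hc
    generalize hx : ((kd K, ((HCTL.xuntil φ₁ φ₂).enc, M), E, cur, i) : St) = x at *
    generalize bnd K.n (HCTL.xuntil φ₁ φ₂).enc M i = B at *
    have u : ∀ c j, upd x c j = (kd K, (c, M), E, cur, j) := by
      intro c j; rw [← hx]; rfl
    have hxi : x.2.2.2.2 = i := by rw [← hx]
    have hd : (dep x).map f =
        (List.range (B + 1)).map (fun j => f (kd K, (φ₁.enc, M), E, cur, j)) ++
        (List.range (B + 1)).map (fun j => f (kd K, (φ₂.enc, M), E, cur, j)) := by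
      unfold dep
      rw [e0, e1, e2, eB]
      simp [Function.comp_def, u]
    have hg1 : ∀ j < B + 1, ((dep x).map f).getD j false = f (kd K, (φ₁.enc, M), E, cur, j) := by
      intro j hj
      rw [hd, List.getD_append _ _ _ _ (by simpa using hj),
        List.getD_eq_getElem _ _ (by simpa using hj)]
      simp
    have hg2 : ∀ j < B + 1, ((dep x).map f).getD (B + 1 + j) false =
        f (kd K, (φ₂.enc, M), E, cur, j) := by
      intro j hj
      rw [hd, List.getD_append_right _ _ _ _ (by simp), 
        List.getD_eq_getElem _ _ (by simpa using hj)]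
      simp
    unfold comb
    simp only [e0]
    simp only [OfNat.ofNat_ne_zero, OfNat.ofNat_ne_one, if_false, if_true, decide_eq_true_eq,
      Nat.reduceEqDiff]
    unfold UP
    rw [eB, hxi]
    constructor
    · rintro ⟨k, hk, hik, hk2, hj⟩
      rw [hg2 k hk, h2] at hk2
      refine ⟨k, hik, hk2, fun j hij hjk => ?_⟩
      rcases hj j hjk with h | h
      · omega
      · rwa [hg1 j (by omega), h1] at h
    · intro hs
      obtain ⟨k, hkB, hik, hk2, hj⟩ := hub hs
      refine ⟨k, by omega, hik, ?_, fun j hjk => ?_⟩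
      · rw [hg2 k (by omega), h2]; exact hk2
      · by_cases h : j < i
        · exact Or.inl h
        · right
          rw [hg1 j (by omega), h1]
          exact hj j (by omega) hjk
  | ex π φ ih =>
    intro M E cur i Pi curF hM hPi hc hE hcur
    rw [hf]
    have e0 : tg (kd K, ((HCTL.ex π φ).enc, M), E, cur, i) = 5 := by simp [tg, HCTL.enc]
    have e1 : r1 (kd K, ((HCTL.ex π φ).enc, M), E, cur, i) = π := by
      simp [r1, r0, HCTL.enc]
    have e2 : r2 (kd K, ((HCTL.ex π φ).enc, M), E, cur, i) = φ.enc := by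
      simp [r2, r0, HCTL.enc]
    have eB : bx (kd K, ((HCTL.ex π φ).enc, M), E, cur, i) =
      bnd K.n (HCTL.ex π φ).enc M i := rfl
    have hub := ex_bound (K := K) (π := π) (φ := φ) (i := i) hM hPi hc
    have hB0 : 0 < bnd K.n (HCTL.ex π φ).enc M i := bnd_pos hM
    have hPi' := fun v => (hPi v).bnd K.n (HCTL.ex π φ).enc i
    generalize hx : ((kd K, ((HCTL.ex π φ).enc, M), E, cur, i) : St) = x at *
    generalize bnd K.n (HCTL.ex π φ).enc M i = B at *
    have u : ∀ w, ent x w = (kd K, (φ.enc, B), (π, w) :: E, w, i) := by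
      intro w; unfold ent; rw [e1, e2, eB, ← hx]
    have step : ∀ (w : List ℕ) (p : ℕ → Fin K.n), w.length = 2 * B → (∀ k, (p k).val = rd w k) →
        (f (kd K, (φ.enc, B), (π, w) :: E, w, i) = true ↔
          HCTL.Sat K (Function.update Pi π p) p i φ) := by
      intro w p hw hp
      have hpl : Lasso B p := lasso_val (rd_lasso hw) hp
      apply ih B _ _ _ _ _ hB0 _ hpl _ hp
      · intro v
        by_cases hv : v = π
        · subst hv; simpa using hpl
        · rw [Function.update_of_ne hv]; exact hPi' v
      · intro v k
        by_cases hv : v = π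
        · subst hv; simpa using hp k
        · have hb : (v == π) = false := by simpa using hv
          rw [Function.update_of_ne hv, hE]
          simp only [List.lookup, hb]
    have hd : dep x = ((allL K.n (2 * B)).filter
        (fun w => decide (vld (kd K).2.1 (curF i).val w))).map
          (fun w => (kd K, (φ.enc, B), (π, w) :: E, w, i)) := by
      unfold dep
      rw [e0, eB]
      have hu : ent x = (fun w => (kd K, (φ.enc, B), (π, w) :: E, w, i)) := funext u
      rw [hu, hcur, ← hx]
      simp [kd]
    unfold comb
    simp only [e0]
    simp only [OfNat.ofNat_ne_zero, OfNat.ofNat_ne_one, if_false, decide_eq_true_eq,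
      Nat.reduceEqDiff]
    rw [hd]
    simp only [List.mem_map, List.mem_filter, decide_eq_true_eq, exists_exists_and_eq_and]
    constructor
    · rintro ⟨w, ⟨hw, hv⟩, hfw⟩
      obtain ⟨hl, hn⟩ := mem_allL.1 hw
      have hp : ∀ k, ((⟨rd w k, rd_lt hB0 hl hn k⟩ : Fin K.n)).val = rd w k := fun _ => rfl
      exact ⟨fun k => ⟨rd w k, rd_lt hB0 hl hn k⟩, path_of_vld hB0 hl hp hv,
        (step w _ hl hp).1 hfw⟩
    · intro hs
      obtain ⟨p, hpl, hpath, hsat⟩ := hub hs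
      have hp := fun k => (rd_path hB0 hpl k).symm
      have hl : ((List.range (2 * B)).map (fun k => (p k).val)).length = 2 * B := by simp
      refine ⟨_, ⟨mem_allL.2 ⟨hl, ?_⟩, vld_of_path hp hpath⟩, (step _ p hl hp).2 hsat⟩
      intro s hs
      obtain ⟨k, _, rfl⟩ := List.mem_map.1 hs
      exact (p k).isLt

/-- Decoding of a Kripke structure. -/
def dk (c : ℕ) : KD :=
  ((c.unpair.1, c.unpair.2.unpair.1),
    (Encodable.decode (α := List (List ℕ)) c.unpair.2.unpair.2.unpair.1).getD [],
    (Encodable.decode (α := List (List ℕ)) c.unpair.2.unpair.2.unpair.2).getD [])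

theorem dk_enc (K : FinKripke) : dk K.enc = kd K := by
  simp only [dk, FinKripke.enc, Nat.unpair_pair, Encodable.encodek, Option.getD_some, kd]

theorem prim_dk : Primrec dk := by
  have u1 : Primrec (fun c : ℕ => c.unpair.1) := Primrec.fst.comp Primrec.unpair
  have u2 : Primrec (fun c : ℕ => c.unpair.2) := Primrec.snd.comp Primrec.unpair
  have h2 : Primrec (fun c : ℕ => c.unpair.2.unpair.2) := u2.comp u2
  have hd : Primrec (fun c : ℕ => (Encodable.decode (α := List (List ℕ)) c).getD []) :=
    Primrec.option_getD.comp Primrec.decode (Primrec.const [])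
  exact Primrec.pair (Primrec.pair u1 (u1.comp u2))
    (Primrec.pair (hd.comp (u1.comp h2)) (hd.comp (u2.comp h2)))

def start (N : ℕ) : St :=
  (dk N.unpair.1, (N.unpair.2, 1), [],
    [(dk N.unpair.1).1.2, (dk N.unpair.1).1.2], 0)

theorem prim_start : Primrec start := by
  have u1 : Primrec (fun c : ℕ => dk c.unpair.1) := prim_dk.comp (Primrec.fst.comp Primrec.unpair)
  have u2 : Primrec (fun c : ℕ => c.unpair.2) := Primrec.snd.comp Primrec.unpair
  have hi : Primrec (fun c : ℕ => (dk c.unpair.1).1.2) :=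
    Primrec.snd.comp (Primrec.fst.comp u1)
  exact Primrec.pair u1 (Primrec.pair (Primrec.pair u2 (Primrec.const 1))
    (Primrec.pair (Primrec.const []) (Primrec.pair
      (Primrec.list_cons.comp hi (Primrec.list_cons.comp hi (Primrec.const [])))
      (Primrec.const 0))))

theorem rd_const (a k : ℕ) : rd [a, a] k = a := by
  rw [rd_eq (M := 1) (by simp)]
  split_ifs with h
  · obtain rfl : k = 0 := by omega
    rfl
  · simp [Nat.mod_one]

end HC


/-- **The HyperCTL* model checking problem is decidable**: there is a
computable (total) function that, given (the encoding of) a finite Kripke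
structure `K` and a HyperCTL* sentence `φ`, decides whether `K ⊨ φ`. -/
theorem hyperCTLstar_model_checking_decidable :
    ∃ f : ℕ → Bool, Computable f ∧
      ∀ (K : FinKripke) (φ : HCTL), φ.Sentence →
        (f (Nat.pair K.enc φ.enc) = true ↔ K.Models φ) := by
  obtain ⟨f, hp, hf⟩ := HC.exists_eval
  refine ⟨fun N => f (HC.start N), (hp.comp HC.prim_start).to_comp, ?_⟩
  intro K φ _
  have e : HC.start (Nat.pair K.enc φ.enc) =
      (HC.kd K, (φ.enc, 1), [], [K.init.val, K.init.val], 0) := by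
    simp only [HC.start, Nat.unpair_pair, HC.dk_enc]
    rfl
  change f (HC.start (Nat.pair K.enc φ.enc)) = true ↔ _
  rw [e]
  apply HC.eval_correct f hf K φ 1 _ _ _ _ _ one_pos (fun _ _ _ => rfl) (fun _ _ => rfl)
  · intro v k
    simp [HC.rd_const]
  · intro k
    simp [HC.rd_const]
end

section
/- The model checking problem for S1S[E], monadic second-order logic of one successor extended with the equal-level predicate, is undecidable: there is no algorithm that, given a finite Kripke structure K and a closed S1S[E] formula φ, decides whether Tr(K, s₀) ⊨ φ. -/
/-!
STATEMENT 5: The model checking problem for S1S[E], monadic second-order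
logic of one successor extended with the equal-level predicate, is
undecidable: there is no algorithm that, given a finite Kripke structure K
and a closed S1S[E] formula φ, decides whether Tr(K, s₀) ⊨ φ.
-/

/-- A trace over the atomic propositions (drawn from `ℕ`). -/
abbrev Trace : Type := ℕ → Set ℕ

/-- Second-order variables: ordinary (quantifiable) variables `Sum.inl n`,
and the designated variables `X_a = Sum.inr a` for atomic propositions `a`. -/
abbrev SOVar : Type := ℕ ⊕ ℕ

/-- S1S[E] terms: `x | min(x) | Succ(τ)`. -/
inductive S1STerm : Type
  | var : ℕ → S1STerm
  | min : ℕ → S1STerm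
  | succ : S1STerm → S1STerm

/-- The value of a term in the domain `T × ℕ` (a trace and a position). -/
def S1STerm.val (V₁ : ℕ → Trace × ℕ) : S1STerm → Trace × ℕ
  | .var x => V₁ x
  | .min x => ((V₁ x).1, 0)
  | .succ τ => ((τ.val V₁).1, (τ.val V₁).2 + 1)

/-- S1S[E] formulas:
`τ ∈ X | τ = τ | E(τ, τ) | ¬φ | φ ∨ φ | ∃x.φ | ∃X.φ`. -/
inductive S1SE : Type
  | mem : S1STerm → SOVar → S1SE
  | eq : S1STerm → S1STerm → S1SE
  | eqlevel : S1STerm → S1STerm → S1SE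
  | not : S1SE → S1SE
  | or : S1SE → S1SE → S1SE
  | exFO : ℕ → S1SE → S1SE
  | exSO : ℕ → S1SE → S1SE

/-- Satisfaction `T, V₁, V₂ ⊨ φ`: first-order variables range over `T × ℕ`,
second-order variables over subsets of `T × ℕ`. -/
def S1SE.Sat (T : Set Trace) :
    (ℕ → Trace × ℕ) → (SOVar → Set (Trace × ℕ)) → S1SE → Prop
  | V₁, V₂, .mem τ X => τ.val V₁ ∈ V₂ X
  | V₁, _, .eq τ₁ τ₂ => τ₁.val V₁ = τ₂.val V₁
  | V₁, _, .eqlevel τ₁ τ₂ => (τ₁.val V₁).2 = (τ₂.val V₁).2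
  | V₁, V₂, .not φ => ¬ S1SE.Sat T V₁ V₂ φ
  | V₁, V₂, .or φ₁ φ₂ => S1SE.Sat T V₁ V₂ φ₁ ∨ S1SE.Sat T V₁ V₂ φ₂
  | V₁, V₂, .exFO x φ =>
      ∃ v : Trace × ℕ, v.1 ∈ T ∧ S1SE.Sat T (Function.update V₁ x v) V₂ φ
  | V₁, V₂, .exSO X φ =>
      ∃ A : Set (Trace × ℕ), A ⊆ { v | v.1 ∈ T } ∧
        S1SE.Sat T V₁ (Function.update V₂ (Sum.inl X) A) φ

/-- Free first-order variables. -/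
def S1STerm.fv : S1STerm → Finset ℕ
  | .var x => {x}
  | .min x => {x}
  | .succ τ => τ.fv

/-- Free first-order variables of a formula. -/
def S1SE.freeFO : S1SE → Finset ℕ
  | .mem τ _ => τ.fv
  | .eq τ₁ τ₂ => τ₁.fv ∪ τ₂.fv
  | .eqlevel τ₁ τ₂ => τ₁.fv ∪ τ₂.fv
  | .not φ => φ.freeFO
  | .or φ₁ φ₂ => φ₁.freeFO ∪ φ₂.freeFO
  | .exFO x φ => φ.freeFO \ {x}
  | .exSO _ φ => φ.freeFO

/-- Free ordinary second-order variables (the designated variables `X_a`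
may occur freely in a closed formula). -/
def S1SE.freeSO : S1SE → Finset ℕ
  | .mem _ X => match X with | .inl n => {n} | .inr _ => ∅
  | .eq _ _ => ∅
  | .eqlevel _ _ => ∅
  | .not φ => φ.freeSO
  | .or φ₁ φ₂ => φ₁.freeSO ∪ φ₂.freeSO
  | .exFO _ φ => φ.freeSO
  | .exSO X φ => φ.freeSO \ {X}

/-- A closed S1S[E] formula (the designated variables `X_a` may occur). -/
def S1SE.Closed (φ : S1SE) : Prop := φ.freeFO = ∅ ∧ φ.freeSO = ∅

/-- `T ⊨ φ` for closed `φ`: each free `X_a` is interpreted as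
`{(t, n) ∈ T × ℕ | a ∈ t(n)}`. -/
def TSat (T : Set Trace) (φ : S1SE) : Prop :=
  S1SE.Sat T (fun _ => ((fun _ => (∅ : Set ℕ)), 0))
    (fun X => match X with
      | .inl _ => (∅ : Set (Trace × ℕ))
      | .inr a => { v : Trace × ℕ | v.1 ∈ T ∧ a ∈ v.1 v.2 }) φ

/-- Paths of `K` starting in the initial state. -/
def FinKripke.IsPath (K : FinKripke) (p : ℕ → Fin K.n) : Prop :=
  p 0 = K.init ∧ ∀ i, p (i + 1) ∈ K.trans (p i)

/-- The set of traces `Tr(K, s₀)`. -/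
def FinKripke.Traces (K : FinKripke) : Set Trace :=
  { t | ∃ p, K.IsPath p ∧ t = fun i => ((K.label (p i) : Finset ℕ) : Set ℕ) }

/-- An explicit (injective) numerical encoding of S1S[E] terms. -/
def S1STerm.enc : S1STerm → ℕ
  | .var x => Nat.pair 0 x
  | .min x => Nat.pair 1 x
  | .succ τ => Nat.pair 2 τ.enc

/-- An explicit (injective) numerical encoding of S1S[E] formulas. -/
def S1SE.enc : S1SE → ℕ
  | .mem τ X => Nat.pair 0 (Nat.pair τ.enc (Encodable.encode X))
  | .eq τ₁ τ₂ => Nat.pair 1 (Nat.pair τ₁.enc τ₂.enc)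
  | .eqlevel τ₁ τ₂ => Nat.pair 2 (Nat.pair τ₁.enc τ₂.enc)
  | .not φ => Nat.pair 3 φ.enc
  | .or φ₁ φ₂ => Nat.pair 4 (Nat.pair φ₁.enc φ₂.enc)
  | .exFO x φ => Nat.pair 5 (Nat.pair x φ.enc)
  | .exSO X φ => Nat.pair 6 (Nat.pair X φ.enc)

namespace S1SEProof

/-- The fixed two-state Kripke structure: all traces over `{0}` starting with `∅`. -/
def KK : FinKripke where
  n := 2
  init := 0
  trans := fun _ => Finset.univ
  trans_nonempty := fun _ => ⟨0, Finset.mem_univ _⟩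
  label := fun s => if s = 0 then ∅ else {0}

theorem mem_T (t : Trace) : t ∈ KK.Traces ↔ t 0 = ∅ ∧ ∀ n, t n = ∅ ∨ t n = {0} := by
  classical
  constructor
  · rintro ⟨p, ⟨h0, -⟩, rfl⟩
    have h0' : p 0 = (0 : Fin 2) := h0
    constructor
    · simp [KK, h0']
    · intro n
      by_cases h : p n = (0 : Fin 2)
      · left; simp [KK, h]
      · right; simp [KK]; exact h
  · rintro ⟨h0, h⟩
    refine ⟨fun n => if t n = ∅ then (0 : Fin 2) else (1 : Fin 2), ⟨?_, ?_⟩, ?_⟩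
    · simp [KK, h0]
    · intro i; exact Finset.mem_univ (α := Fin 2) _
    · funext i
      rcases h i with hi | hi
      · simp [KK, hi]
      · simp [KK, hi]

def sing (m : ℕ) : Trace := fun n => {a | a = 0 ∧ n = m + 1}

theorem sing_mem (m : ℕ) : sing m ∈ KK.Traces := by
  rw [mem_T]
  constructor
  · simp [sing]
  · intro n
    by_cases h : n = m + 1 <;> simp [sing, h]

theorem sing_inj {m n : ℕ} (h : sing m = sing n) : m = n := by
  have : (0 : ℕ) ∈ sing n (m + 1) := by rw [← h]; simp [sing]
  simpa [sing] using this

theorem eq_sing {t : Trace} (ht : t ∈ KK.Traces) (m : ℕ)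
    (h : ∀ n, 0 ∈ t n ↔ n = m + 1) : t = sing m := by
  funext n
  rw [mem_T] at ht
  have := h n
  rcases ht.2 n with h' | h'
  · rw [h'] at this ⊢
    simp at this
    simp [sing, this]
  · rw [h'] at this ⊢
    simp at this
    simp [sing, this]

/-- Good environments. -/
def Good (V₁ : ℕ → Trace × ℕ) (V₂ : SOVar → Set (Trace × ℕ)) : Prop :=
  (∀ x, (V₁ x).1 ∈ KK.Traces) ∧ V₂ (Sum.inr 0) = {v | v.1 ∈ KK.Traces ∧ 0 ∈ v.1 v.2}

theorem Good.upd₁ {V₁ V₂} (h : Good V₁ V₂) (x : ℕ) {v : Trace × ℕ} (hv : v.1 ∈ KK.Traces) :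
    Good (Function.update V₁ x v) V₂ := by
  refine ⟨fun y => ?_, h.2⟩
  by_cases hy : y = x
  · subst hy; simpa using hv
  · simpa [hy] using h.1 y

theorem Good.upd₂ {V₁ V₂} (h : Good V₁ V₂) (X : ℕ) (A : Set (Trace × ℕ)) :
    Good V₁ (Function.update V₂ (Sum.inl X) A) := by
  refine ⟨h.1, ?_⟩
  simpa using h.2

abbrev Lev (V₁ : ℕ → Trace × ℕ) : ℕ → ℕ := fun x => (V₁ x).2
abbrev Rl (V₂ : SOVar → Set (Trace × ℕ)) : ℕ → ℕ → Prop := fun m n => (sing m, n) ∈ V₂ (Sum.inl 0)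

theorem Lev_upd (V₁ : ℕ → Trace × ℕ) (x : ℕ) (v : Trace × ℕ) :
    Lev (Function.update V₁ x v) = Function.update (Lev V₁) x v.2 := by
  funext y
  by_cases hy : y = x
  · subst hy; simp [Lev]
  · simp [Lev, hy]

/-- Definability of a predicate on number environments and one binary relation. -/
def DN (Q : (ℕ → ℕ) → (ℕ → ℕ → Prop) → Prop) : Prop :=
  ∃ φ : S1SE, ∀ V₁ V₂, Good V₁ V₂ → (S1SE.Sat KK.Traces V₁ V₂ φ ↔ Q (Lev V₁) (Rl V₂))

theorem DN.congr {Q Q'} (h : DN Q) (hh : ∀ e P, Q e P ↔ Q' e P) : DN Q' := by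
  obtain ⟨φ, hφ⟩ := h
  exact ⟨φ, fun V₁ V₂ hg => (hφ V₁ V₂ hg).trans (hh _ _)⟩

theorem DN.not {Q} (h : DN Q) : DN (fun e P => ¬ Q e P) := by
  obtain ⟨φ, hφ⟩ := h
  exact ⟨.not φ, fun V₁ V₂ hg => by simp [S1SE.Sat, hφ V₁ V₂ hg]⟩

theorem DN.or {Q R} (h : DN Q) (h' : DN R) : DN (fun e P => Q e P ∨ R e P) := by
  obtain ⟨φ, hφ⟩ := h
  obtain ⟨ψ, hψ⟩ := h'
  exact ⟨.or φ ψ, fun V₁ V₂ hg => by simp [S1SE.Sat, hφ V₁ V₂ hg, hψ V₁ V₂ hg]⟩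

theorem DN.and {Q R} (h : DN Q) (h' : DN R) : DN (fun e P => Q e P ∧ R e P) :=
  (h.not.or h'.not).not.congr (fun _ _ => by tauto)

theorem DN.imp {Q R} (h : DN Q) (h' : DN R) : DN (fun e P => Q e P → R e P) :=
  (h.not.or h').congr (fun _ _ => by tauto)

theorem DN.ex (x : ℕ) {Q} (h : DN Q) : DN (fun e P => ∃ n, Q (Function.update e x n) P) := by
  obtain ⟨φ, hφ⟩ := h
  refine ⟨.exFO x φ, fun V₁ V₂ hg => ?_⟩
  simp only [S1SE.Sat]
  constructor
  · rintro ⟨v, hv, hs⟩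
    rw [hφ _ _ (hg.upd₁ x hv), Lev_upd] at hs
    exact ⟨_, hs⟩
  · rintro ⟨n, hn⟩
    refine ⟨(sing 0, n), sing_mem 0, ?_⟩
    rw [hφ _ _ (hg.upd₁ x (sing_mem 0)), Lev_upd]
    exact hn

theorem DN.all (x : ℕ) {Q} (h : DN Q) : DN (fun e P => ∀ n, Q (Function.update e x n) P) :=
  (h.not.ex x).not.congr (fun _ _ => by simp)

theorem DN.exR {Q} (h : DN Q) : DN (fun e _ => ∃ R, Q e R) := by
  obtain ⟨φ, hφ⟩ := h
  refine ⟨.exSO 0 φ, fun V₁ V₂ hg => ?_⟩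
  simp only [S1SE.Sat]
  constructor
  · rintro ⟨A, hA, hs⟩
    rw [hφ _ _ (hg.upd₂ 0 A)] at hs
    exact ⟨_, hs⟩
  · rintro ⟨R, hR⟩
    refine ⟨{v | ∃ m, v.1 = sing m ∧ R m v.2}, ?_, ?_⟩
    · rintro v ⟨m, hm, -⟩
      simp only [Set.mem_ofPred_eq, hm]
      exact sing_mem m
    · rw [hφ _ _ (hg.upd₂ 0 _)]
      convert hR using 1
      funext m n
      simp only [Rl, Function.update_self, Set.mem_ofPred_eq, eq_iff_iff]
      constructor
      · rintro ⟨m', h, h'⟩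
        rw [sing_inj h]; exact h'
      · intro h; exact ⟨m, rfl, h⟩

theorem DN.allR {Q} (h : DN Q) : DN (fun e _ => ∀ R, Q e R) :=
  h.not.exR.not.congr (fun _ _ => by simp)

theorem DN.eq (x y : ℕ) : DN (fun e _ => e x = e y) :=
  ⟨.eqlevel (.var x) (.var y), fun V₁ V₂ _ => by simp [S1SE.Sat, S1STerm.val]⟩

theorem DN.succ (x y : ℕ) : DN (fun e _ => e x = e y + 1) :=
  ⟨.eqlevel (.var x) (.succ (.var y)), fun V₁ V₂ _ => by simp [S1SE.Sat, S1STerm.val]⟩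

theorem DN.zero (x : ℕ) : DN (fun e _ => e x = 0) :=
  ⟨.eqlevel (.var x) (.min x), fun V₁ V₂ _ => by simp [S1SE.Sat, S1STerm.val]⟩

def fand (φ ψ : S1SE) : S1SE := .not (.or (.not φ) (.not ψ))

theorem sat_fand (T V₁ V₂ φ ψ) : S1SE.Sat T V₁ V₂ (fand φ ψ) ↔
    S1SE.Sat T V₁ V₂ φ ∧ S1SE.Sat T V₁ V₂ ψ := by
  simp only [fand, S1SE.Sat]; tauto

theorem DN.rel (x y : ℕ) : DN (fun e P => P (e x) (e y)) := by
  let z := x + y + 1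
  let u := x + y + 2
  -- bad `u`: on the trace of `z`, yet membership and level disagree
  let A : S1SE := .mem (.var u) (Sum.inr 0)
  let B : S1SE := .eqlevel (.var u) (.succ (.var x))
  let bad : S1SE := .exFO u (fand (.eq (.min u) (.min z))
    (.not (.or (fand A B) (fand (.not A) (.not B)))))
  refine ⟨.exFO z (fand (.eqlevel (.var z) (.var y))
    (fand (.mem (.var z) (Sum.inl 0)) (.not bad))), fun V₁ V₂ hg => ?_⟩
  have h1 : y ≠ z := by omega
  have h2 : z ≠ u := by omega
  have h3 : x ≠ u := by omega
  have h4 : x ≠ z := by omega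
  simp only [S1SE.Sat, sat_fand, S1STerm.val, bad, A, B, hg.2, Function.update_self,
    Function.update_of_ne h1, Function.update_of_ne h2, Function.update_of_ne h3,
    Function.update_of_ne h4, Lev, Rl, Set.mem_ofPred_eq]
  constructor
  · rintro ⟨v, hv, hl, hm, hb⟩
    have : v.1 = sing (V₁ x).2 := by
      apply eq_sing hv
      intro n
      by_contra hcon
      apply hb
      refine ⟨(v.1, n), hv, rfl, ?_⟩
      simp only [hv, true_and]
      tauto
    rw [← this, ← hl]
    exact hm
  · intro h
    refine ⟨(sing (V₁ x).2, (V₁ y).2), sing_mem _, rfl, h, ?_⟩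
    rintro ⟨v, hv, he, hn⟩
    apply hn
    simp only [Prod.mk.injEq, and_true] at he
    rw [he]
    simp only [sing_mem, true_and, sing, Set.mem_ofPred_eq]
    tauto

def D2 (R : ℕ → ℕ → Prop) : Prop := ∀ x y, DN (fun e _ => R (e x) (e y))
def D3 (R : ℕ → ℕ → ℕ → Prop) : Prop := ∀ x y z, DN (fun e _ => R (e x) (e y) (e z))
def D4 (R : ℕ → ℕ → ℕ → ℕ → Prop) : Prop :=
  ∀ x y z w, DN (fun e _ => R (e x) (e y) (e z) (e w))

inductive It (B : ℕ → ℕ → Prop) (S : ℕ → ℕ → ℕ → ℕ → Prop) (p : ℕ) : ℕ → ℕ → Prop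
  | zero {b} : B p b → It B S p 0 b
  | succ {m b b'} : It B S p m b → S p m b b' → It B S p (m + 1) b'

theorem D3.iter {B S} (hB : D2 B) (hS : D4 S) : D3 (It B S) := by
  intro x y z
  let k := x + y + z
  have base : DN (fun e P => ∀ a, a = 0 → ∀ b, B (e x) b → P a b) := by
    refine ((DN.imp (DN.zero (k+1)) (((hB x (k+2)).imp (DN.rel (k+1) (k+2))).all (k+2))).all
      (k+1)).congr ?_
    intro e P
    simp (disch := omega) [Function.update_of_ne]
  have step : DN (fun e P => ∀ m b b' m', m' = m + 1 → P m b → S (e x) m b b' → P m' b') := by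
    refine ((((((DN.succ (k+4) (k+1)).imp ((DN.rel (k+1) (k+2)).imp
      ((hS x (k+1) (k+2) (k+3)).imp (DN.rel (k+4) (k+3))))).all (k+4)).all (k+3)).all (k+2)).all
      (k+1)).congr ?_
    intro e P
    simp (disch := omega) [Function.update_of_ne]
  refine (base.imp (step.imp (DN.rel y z))).allR.congr ?_
  intro e _
  constructor
  · intro h
    apply h (It B S (e x))
    · rintro a rfl b hb; exact .zero hb
    · rintro m b b' m' rfl h1 h2; exact .succ h1 h2
  · intro h P h0 h1
    generalize e y = m at h
    generalize e z = b at h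
    induction h with
    | zero hb => exact h0 _ rfl _ hb
    | succ _ hs ih => exact h1 _ _ _ _ rfl ih hs

theorem d_add : D3 (fun a b c => c = a + b) := by
  have h : D3 (It (fun p b => b = p) (fun _ _ b b' => b' = b + 1)) :=
    D3.iter (fun x y => DN.eq y x) (fun _ _ z w => DN.succ w z)
  have key : ∀ a b c, It (fun p b => b = p) (fun _ _ b b' => b' = b + 1) a b c ↔ c = a + b := by
    intro a b c
    constructor
    · intro h
      induction h with
      | zero h => simpa using h
      | succ _ hs ih => omega
    · rintro rfl
      induction b with
      | zero => exact .zero rfl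
      | succ n ih => exact .succ ih (by omega)
  intro x y z
  exact (h x y z).congr (fun e _ => key _ _ _)

theorem d_lt : D2 (fun a b => a < b) := by
  intro x y
  refine (((d_add x (x+y+1) (x+y+2)).and (DN.succ y (x+y+2))).ex (x+y+2) |>.ex (x+y+1)).congr ?_
  intro e _
  simp (disch := omega) [Function.update_of_ne]
  constructor
  · rintro ⟨n, h⟩; omega
  · intro h; exact ⟨e y - e x - 1, by omega⟩

theorem d_sq : D2 (fun a b => b = a * a) := by
  have hS : D4 (fun _ m b b' => b' = b + (m + m) + 1) := by
    intro x y z w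
    let k := x + y + z + w
    refine (((d_add y y (k+1)).and ((d_add z (k+1) (k+2)).and (DN.succ w (k+2)))).ex (k+2)
      |>.ex (k+1)).congr ?_
    intro e _
    simp (disch := omega) [Function.update_of_ne]
  have h := D3.iter (B := fun _ b => b = 0) (fun x y => DN.zero y) hS
  have key : ∀ p a c, It (fun _ b => b = 0) (fun _ m b b' => b' = b + (m + m) + 1) p a c ↔
      c = a * a := by
    intro p a c
    constructor
    · intro h
      induction h with
      | zero h => simpa using h
      | succ _ hs ih => rw [hs, ih]; ring
    · rintro rfl
      induction a with
      | zero => exact .zero rfl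
      | succ n ih => exact .succ ih (by ring)
  intro x y
  exact (h x x y).congr (fun e _ => key _ _ _)

theorem d_pair : D3 (fun a b c => c = Nat.pair a b) := by
  intro x y z
  let k := x + y + z
  have h1 : DN (fun e _ => e z = e y * e y + e x) := by
    refine (((d_sq y (k+1)).and (d_add (k+1) x z)).ex (k+1)).congr ?_
    intro e _
    simp (disch := omega) [Function.update_of_ne]
  have h2 : DN (fun e _ => e z = e x * e x + e x + e y) := by
    refine (((d_sq x (k+1)).and ((d_add (k+1) x (k+2)).and (d_add (k+2) y z))).ex (k+2)
      |>.ex (k+1)).congr ?_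
    intro e _
    simp (disch := omega) [Function.update_of_ne]
  refine (((d_lt x y).and h1).or ((d_lt x y).not.and h2)).congr ?_
  intro e _
  by_cases h : e x < e y <;> simp [Nat.pair, h]

def G (f : ℕ →. ℕ) : Prop := D2 (fun a b => b ∈ f a)

theorem G_of_partrec {f : ℕ →. ℕ} (hf : Nat.Partrec f) : G f := by
  induction hf with
  | zero =>
    intro x y
    exact (DN.zero y).congr (fun e _ => by simp [pure, PFun.pure])
  | succ =>
    intro x y
    exact (DN.succ y x).congr (fun e _ => by simp)
  | left =>
    intro x y
    refine ((d_pair y (x+y+1) x).ex (x+y+1)).congr ?_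
    intro e _
    simp (disch := omega) [Function.update_of_ne]
    constructor
    · rintro ⟨n, h⟩; rw [h]; simp
    · intro h; exact ⟨(Nat.unpair (e x)).2, by rw [h]; simp⟩
  | right =>
    intro x y
    refine ((d_pair (x+y+1) y x).ex (x+y+1)).congr ?_
    intro e _
    simp (disch := omega) [Function.update_of_ne]
    constructor
    · rintro ⟨n, h⟩; rw [h]; simp
    · intro h; exact ⟨(Nat.unpair (e x)).1, by rw [h]; simp⟩
  | pair _ _ hf hg =>
    intro x y
    refine (((hf x (x+y+1)).and ((hg x (x+y+2)).and (d_pair (x+y+1) (x+y+2) y))).ex (x+y+2)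
      |>.ex (x+y+1)).congr ?_
    intro e _
    simp (disch := omega) [Function.update_of_ne, Seq.seq, eq_comm]
  | comp _ _ hf hg =>
    intro x y
    refine (((hg x (x+y+1)).and (hf (x+y+1) y)).ex (x+y+1)).congr ?_
    intro e _
    simp (disch := omega) only [Function.update_of_ne, Function.update_self]
    exact Part.mem_bind_iff.symm
  | @prec f g _ _ hf hg =>
    have hS : D4 (fun p m b b' => b' ∈ g (Nat.pair p (Nat.pair m b))) := by
      intro x y z w
      let k := x + y + z + w
      refine (((d_pair y z (k+1)).and ((d_pair x (k+1) (k+2)).and (hg (k+2) w))).ex (k+2)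
        |>.ex (k+1)).congr ?_
      intro e _
      simp (disch := omega) [Function.update_of_ne]
    have key : ∀ a n c, It (fun a b => b ∈ f a) (fun p m b b' => b' ∈ g (Nat.pair p (Nat.pair m b)))
        a n c ↔ c ∈ (n.rec (f a) (fun y IH => do let i ← IH; g (Nat.pair a (Nat.pair y i))) : Part ℕ) := by
      intro a n
      induction n with
      | zero =>
        intro c
        constructor
        · rintro (h | _); exact h
        · intro h; exact .zero h
      | succ n ih =>
        intro c
        simp only [Part.bind_eq_bind, Part.mem_bind_iff]
        constructor
        · rintro (_ | ⟨h1, h2⟩)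
          exact ⟨_, (ih _).1 h1, h2⟩
        · rintro ⟨b, h1, h2⟩
          exact .succ ((ih _).2 h1) h2
    have hI := D3.iter hf hS
    intro x y
    let k := x + y
    refine (((d_pair (k+1) (k+2) x).and (hI (k+1) (k+2) y)).ex (k+2) |>.ex (k+1)).congr ?_
    intro e _
    simp (disch := omega) only [Function.update_of_ne, Function.update_self, key, Nat.unpaired]
    constructor
    · rintro ⟨a, n, h, h'⟩
      rw [h, Nat.unpair_pair]
      exact h'
    · intro h
      exact ⟨_, _, (Nat.pair_unpair _).symm, h⟩
  | @rfind f _ hf =>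
    intro x y
    let k := x + y
    have h1 : DN (fun e _ => 0 ∈ f (Nat.pair (e x) (e y))) := by
      refine (((d_pair x y (k+1)).and ((DN.zero (k+2)).and (hf (k+1) (k+2)))).ex (k+2)
        |>.ex (k+1)).congr ?_
      intro e _
      simp (disch := omega) [Function.update_of_ne]
    have h2 : DN (fun e _ => ∀ m, m < e y → ∃ v c, ¬ v = 0 ∧ c = Nat.pair (e x) m ∧ v ∈ f c) := by
      refine (((d_lt (k+1) y).imp (((DN.zero (k+2)).not.and ((d_pair x (k+1) (k+3)).and
        (hf (k+3) (k+2)))).ex (k+3) |>.ex (k+2))).all (k+1)).congr ?_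
      intro e _
      simp (disch := omega) [Function.update_of_ne]
    refine (h1.and h2).congr ?_
    intro e _
    refine Iff.trans ?_ Nat.mem_rfind.symm
    simp only [Part.map_eq_map, Part.mem_map_iff]
    constructor
    · rintro ⟨h, h'⟩
      refine ⟨⟨0, h, by simp⟩, ?_⟩
      intro m hm
      obtain ⟨v, c, hv, rfl, hc⟩ := h' m hm
      exact ⟨v, hc, by simpa using hv⟩
    · rintro ⟨⟨v, h, hv⟩, h'⟩
      have : v = 0 := by simpa using hv
      subst this
      refine ⟨h, ?_⟩
      intro m hm
      obtain ⟨v, hv, h0⟩ := h' hm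
      exact ⟨v, _, by simpa using h0, rfl, hv⟩

/-! ### Closing formulas -/

def clFO : ℕ → S1SE → S1SE
  | 0, φ => φ
  | n + 1, φ => .exFO n (clFO n φ)

def clSO : ℕ → S1SE → S1SE
  | 0, φ => φ
  | n + 1, φ => .exSO n (clSO n φ)

theorem clFO_freeFO (n φ) : (clFO n φ).freeFO = φ.freeFO \ Finset.range n := by
  induction n with
  | zero => simp [clFO]
  | succ n ih =>
    ext a
    simp only [clFO, S1SE.freeFO, ih, Finset.mem_sdiff, Finset.mem_range, Finset.mem_singleton,
      and_assoc]
    constructor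
    · rintro ⟨h1, h2, h3⟩; exact ⟨h1, by omega⟩
    · rintro ⟨h1, h2⟩; exact ⟨h1, by omega, by omega⟩

theorem clFO_freeSO (n φ) : (clFO n φ).freeSO = φ.freeSO := by
  induction n with
  | zero => rfl
  | succ n ih => simpa [clFO, S1SE.freeSO] using ih

theorem clSO_freeFO (n φ) : (clSO n φ).freeFO = φ.freeFO := by
  induction n with
  | zero => rfl
  | succ n ih => simpa [clSO, S1SE.freeFO] using ih

theorem clSO_freeSO (n φ) : (clSO n φ).freeSO = φ.freeSO \ Finset.range n := by
  induction n with
  | zero => simp [clSO]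
  | succ n ih =>
    ext a
    simp only [clSO, S1SE.freeSO, ih, Finset.mem_sdiff, Finset.mem_range, Finset.mem_singleton,
      and_assoc]
    constructor
    · rintro ⟨h1, h2, h3⟩; exact ⟨h1, by omega⟩
    · rintro ⟨h1, h2⟩; exact ⟨h1, by omega, by omega⟩

def Const (φ : S1SE) (p : Prop) : Prop :=
  ∀ V₁ V₂, Good V₁ V₂ → (S1SE.Sat KK.Traces V₁ V₂ φ ↔ p)

theorem Const.clFO {φ p} (h : Const φ p) (n : ℕ) : Const (clFO n φ) p := by
  induction n with
  | zero => exact h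
  | succ n ih =>
    intro V₁ V₂ hg
    simp only [S1SEProof.clFO, S1SE.Sat]
    constructor
    · rintro ⟨v, hv, hs⟩
      exact (ih _ _ (hg.upd₁ n hv)).1 hs
    · intro hp
      exact ⟨(sing 0, 0), sing_mem 0, (ih _ _ (hg.upd₁ n (sing_mem 0))).2 hp⟩

theorem Const.clSO {φ p} (h : Const φ p) (n : ℕ) : Const (clSO n φ) p := by
  induction n with
  | zero => exact h
  | succ n ih =>
    intro V₁ V₂ hg
    simp only [S1SEProof.clSO, S1SE.Sat]
    constructor
    · rintro ⟨A, hA, hs⟩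
      exact (ih _ _ (hg.upd₂ n A)).1 hs
    · intro hp
      exact ⟨∅, Set.empty_subset _, (ih _ _ (hg.upd₂ n ∅)).2 hp⟩

def num : ℕ → S1STerm
  | 0 => .min 0
  | n + 1 => .succ (num n)

theorem num_val (V₁ n) : ((num n).val V₁).2 = n := by
  induction n with
  | zero => rfl
  | succ n ih => simp [num, S1STerm.val, ih]

theorem num_fv (n) : (num n).fv = {0} := by
  induction n with
  | zero => rfl
  | succ n ih => simpa [num, S1STerm.fv] using ih

def inst (φ : S1SE) (n : ℕ) : S1SE := .exFO 0 (fand (.eqlevel (.var 0) (num n)) φ)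

def full (M N : ℕ) (φ : S1SE) (n : ℕ) : S1SE := clSO M (clFO N (inst φ n))

theorem primrec_num : Primrec (fun n => (num n).enc) := by
  have : (fun n => (num n).enc) = fun n : ℕ => Nat.rec (motive := fun _ => ℕ) (Nat.pair 1 0)
      (fun _ r => Nat.pair 2 r) n := by
    funext n
    induction n with
    | zero => rfl
    | succ n ih => simp only [num, S1STerm.enc, ih]
  rw [this]
  exact Primrec.nat_rec₁ _ (Primrec₂.natPair.comp (Primrec.const 2) Primrec.snd).to₂

theorem primrec_full (M N φ) : Primrec (fun n => (full M N φ n).enc) := by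
  have P2 : ∀ (c : ℕ) {g : ℕ → ℕ}, Primrec g → Primrec (fun n => Nat.pair c (g n)) :=
    fun c g hg => Primrec₂.natPair.comp (Primrec.const c) hg
  have P2' : ∀ (c : ℕ) {g : ℕ → ℕ}, Primrec g → Primrec (fun n => Nat.pair (g n) c) :=
    fun c g hg => Primrec₂.natPair.comp hg (Primrec.const c)
  have h0 : Primrec (fun n => (inst φ n).enc) := by
    simp only [inst, fand, S1SE.enc]
    exact P2 _ (P2 _ (P2 _ (P2 _ (P2' _ (P2 _ (P2 _ (P2 _ primrec_num)))))))
  have h1 : Primrec (fun n => (clFO N (inst φ n)).enc) := by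
    induction N with
    | zero => exact h0
    | succ N ih => exact P2 _ (P2 _ ih)
  unfold full
  induction M with
  | zero => exact h1
  | succ M ih => exact P2 _ (P2 _ ih)

theorem exists_full {f : ℕ →. ℕ} (hf : Nat.Partrec f) : ∃ M N φ, ∀ n,
    (full M N φ n).Closed ∧ (TSat KK.Traces (full M N φ n) ↔ (f n).Dom) := by
  obtain ⟨φ, hφ⟩ := (G_of_partrec hf 0 1).ex 1
  refine ⟨φ.freeSO.sup id + 1, φ.freeFO.sup id + 1, φ, fun n => ⟨⟨?_, ?_⟩, ?_⟩⟩
  · rw [full, clSO_freeFO, clFO_freeFO]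
    rw [Finset.sdiff_eq_empty_iff_subset]
    intro a ha
    simp only [inst, fand, S1SE.freeFO, S1STerm.fv, num_fv, Finset.mem_sdiff, Finset.mem_union,
      Finset.mem_singleton] at ha
    have : a ∈ φ.freeFO := by tauto
    have := Finset.le_sup (f := id) this
    simp only [id] at this
    simp only [Finset.mem_range]
    exact Nat.lt_succ_of_le this
  · rw [full, clSO_freeSO, clFO_freeSO]
    rw [Finset.sdiff_eq_empty_iff_subset]
    intro a ha
    have : a ∈ φ.freeSO := by
      simpa [inst, fand, S1SE.freeSO] using ha
    have := Finset.le_sup (f := id) this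
    simp only [id] at this
    simp only [Finset.mem_range]
    exact Nat.lt_succ_of_le this
  · have hc : Const (inst φ n) (f n).Dom := by
      intro V₁ V₂ hg
      simp only [inst, S1SE.Sat, sat_fand, num_val]
      constructor
      · rintro ⟨v, hv, h1, h2⟩
        rw [hφ _ _ (hg.upd₁ 0 hv)] at h2
        simp only [S1STerm.val, Function.update_self] at h1
        obtain ⟨b, hb⟩ := h2
        simp [Lev, h1] at hb
        exact Part.dom_iff_mem.2 ⟨b, hb⟩
      · intro h
        obtain ⟨b, hb⟩ := Part.dom_iff_mem.1 h
        refine ⟨(sing 0, n), sing_mem 0, by simp [S1STerm.val], ?_⟩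
        rw [hφ _ _ (hg.upd₁ 0 (sing_mem 0))]
        exact ⟨b, by simpa [Lev] using hb⟩
    apply (hc.clFO _).clSO
    refine ⟨fun _ => ?_, rfl⟩
    rw [mem_T]
    simp

end S1SEProof

/-- **The S1S[E] model checking problem is undecidable**: there is no
computable (total) function that, given (the encoding of) a finite Kripke
structure `K` and a closed S1S[E] formula `φ`, decides whether
`Tr(K, s₀) ⊨ φ`. -/
theorem S1SE_model_checking_undecidable :
    ¬ ∃ f : ℕ → Bool, Computable f ∧
        ∀ (K : FinKripke) (φ : S1SE), φ.Closed →
          (f (Nat.pair K.enc φ.enc) = true ↔ TSat K.Traces φ) := by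
  rintro ⟨F, hF, h⟩
  have hp : Nat.Partrec (fun n => Nat.Partrec.Code.eval (Denumerable.ofNat Nat.Partrec.Code n) 0) := by
    apply Partrec.nat_iff.1
    exact Nat.Partrec.Code.eval_part.comp (Computable.ofNat _) (Computable.const 0)
  obtain ⟨M, N, φ, hφ⟩ := S1SEProof.exists_full hp
  apply ComputablePred.halting_problem 0
  rw [ComputablePred.computable_iff]
  refine ⟨fun c => F (Nat.pair S1SEProof.KK.enc
    (S1SEProof.full M N φ (Encodable.encode c)).enc), ?_, ?_⟩
  · apply hF.comp
    apply Primrec.to_comp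
    exact Primrec₂.natPair.comp (Primrec.const _)
      ((S1SEProof.primrec_full M N φ).comp Primrec.encode)
  · funext c
    have h1 := h S1SEProof.KK _ (hφ (Encodable.encode c)).1
    have h2 := (hφ (Encodable.encode c)).2
    rw [Denumerable.ofNat_encode] at h2
    exact propext (h2.symm.trans h1.symm)
end
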